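/- arXiv:1911.03729 — 2 statements merged into one kernel-verified Lean document; each statement's English description precedes it below -/
import Mathlib

section
/- Let d ≥ 1 and let g be a smooth compactly supported function on (0,∞). Define u₀(Y,s) = ∫₀^∞ e^{isλ} e^{−λ|Y|²} g(λ) λ^d dλ on ℝ^{2d}×ℝ and u(t,Y,s) := u₀(Y, s+4td). Then u is smooth on ℝ×ℝ^{2d}×ℝ, u(0,·,·) = u₀, and u solves the free Schrödinger equation on the Heisenberg group: i∂ₜu(t,Y,s) − Δ_ℍu(t,Y,s) = 0 for all (t,Y,s). In particular the Schrödinger equation on ℍ^d admits solutions that are pure translations in the vertical variable of their initial data. -/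
noncomputable section

open MeasureTheory

/-- The Heisenberg group `ℍ^d`, identified with `ℝ^d × ℝ^d × ℝ`, points `w = (y, η, s)`. -/
abbrev Heis (d : ℕ) : Type := (Fin d → ℝ) × (Fin d → ℝ) × ℝ

/-- `|Y|² = Σ_j y_j² + η_j²` for `w = (Y, s)`. -/
def normYsq {d : ℕ} (w : Heis d) : ℝ := ∑ j, ((w.1 j) ^ 2 + (w.2.1 j) ^ 2)

/-- Partial derivative in `y_j`. -/
noncomputable def pdY {d : ℕ} (j : Fin d) (f : Heis d → ℂ) (w : Heis d) : ℂ :=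
  deriv (fun h : ℝ => f (Function.update w.1 j h, w.2)) (w.1 j)

/-- Partial derivative in `η_j`. -/
noncomputable def pdEta {d : ℕ} (j : Fin d) (f : Heis d → ℂ) (w : Heis d) : ℂ :=
  deriv (fun h : ℝ => f (w.1, Function.update w.2.1 j h, w.2.2)) (w.2.1 j)

/-- Partial derivative in `s`. -/
noncomputable def pdS {d : ℕ} (f : Heis d → ℂ) (w : Heis d) : ℂ :=
  deriv (fun h : ℝ => f (w.1, w.2.1, h)) w.2.2

/-- Horizontal vector field `X_j = ∂_{y_j} + 2 η_j ∂_s`. -/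
noncomputable def vfX {d : ℕ} (j : Fin d) (f : Heis d → ℂ) (w : Heis d) : ℂ :=
  pdY j f w + 2 * (w.2.1 j : ℂ) * pdS f w

/-- Horizontal vector field `Ξ_j = ∂_{η_j} - 2 y_j ∂_s`. -/
noncomputable def vfXi {d : ℕ} (j : Fin d) (f : Heis d → ℂ) (w : Heis d) : ℂ :=
  pdEta j f w - 2 * (w.1 j : ℂ) * pdS f w

/-- The sublaplacian `Δ_ℍ = Σ_j (X_j² + Ξ_j²)`. -/
noncomputable def subLap {d : ℕ} (f : Heis d → ℂ) (w : Heis d) : ℂ :=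
  ∑ j : Fin d, (vfX j (vfX j f) w + vfXi j (vfXi j f) w)

/-- The Fourier–Laplace transform of a continuous compactly supported function is entire. -/
theorem differentiable_integral_exp_mul {φ : ℝ → ℂ} (hφ : Continuous φ)
    (hc : HasCompactSupport φ) :
    Differentiable ℂ (fun z : ℂ => ∫ l in Set.Ioi (0 : ℝ), Complex.exp (Complex.I * z * l) * φ l) := by
  intro z₀
  refine (hasDerivAt_integral_of_dominated_loc_of_deriv_le
    (F := fun (z : ℂ) (l : ℝ) => Complex.exp (Complex.I * z * l) * φ l)
    (F' := fun (z : ℂ) (l : ℝ) => Complex.exp (Complex.I * z * l) * (Complex.I * l) * φ l)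
    (bound := fun l => Real.exp ((‖z₀‖ + 1) * |l|) * |l| * ‖φ l‖)
    (Metric.ball_mem_nhds z₀ one_pos) ?_ ?_ ?_ ?_ ?_ ?_).2.differentiableAt
  · exact .of_forall fun z => (by fun_prop : Continuous _).aestronglyMeasurable
  · exact (Continuous.integrable_of_hasCompactSupport (by fun_prop) hc.mul_left).integrableOn
  · exact (by fun_prop : Continuous _).aestronglyMeasurable
  · refine .of_forall fun l z hz => ?_
    rw [norm_mul, norm_mul, norm_mul, Complex.norm_I, one_mul, Complex.norm_real, Real.norm_eq_abs]
    have hz' : ‖z‖ ≤ ‖z₀‖ + 1 := by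
      have h₁ := norm_sub_norm_le z z₀
      have h₂ : ‖z - z₀‖ < 1 := by simpa [dist_eq_norm] using hz
      linarith
    gcongr
    refine (Complex.norm_exp_le_exp_norm _).trans (Real.exp_le_exp.2 ?_)
    rw [norm_mul, norm_mul, Complex.norm_I, one_mul, Complex.norm_real, Real.norm_eq_abs]
    gcongr
  · exact (Continuous.integrable_of_hasCompactSupport (by fun_prop) hc.norm.mul_left).integrableOn
  · refine .of_forall fun l z _ => ?_
    have h : HasDerivAt (fun z : ℂ => Complex.I * z * l) (Complex.I * l) z := by
      simpa using ((hasDerivAt_id z).const_mul Complex.I).mul_const (l : ℂ)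
    exact h.cexp.mul_const _

/-- The complex coordinate `s + i |Y|²` on the Heisenberg group. -/
def heisCoord {d : ℕ} (w : Heis d) : ℂ := w.2.2 + Complex.I * normYsq w

theorem contDiff_heisCoord {d : ℕ} : ContDiff ℝ (⊤ : ℕ∞) (heisCoord (d := d)) := by
  have h : ContDiff ℝ (⊤ : ℕ∞) (normYsq (d := d)) := by
    unfold normYsq
    fun_prop
  have h₁ := Complex.ofRealCLM.contDiff.comp h
  have h₂ : ContDiff ℝ (⊤ : ℕ∞) (fun w : Heis d => (w.2.2 : ℂ)) :=
    Complex.ofRealCLM.contDiff.comp (by fun_prop : ContDiff ℝ (⊤ : ℕ∞) fun w : Heis d => w.2.2)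
  exact h₂.add (contDiff_const.mul h₁)

theorem hasDerivAt_sum_update_sq {ι : Type*} [Fintype ι] [DecidableEq ι] (y : ι → ℝ) (j : ι) :
    HasDerivAt (fun h : ℝ => ∑ k, Function.update y j h k ^ 2) (2 * y j) (y j) := by
  have h : ∀ k ∈ Finset.univ, HasDerivAt (fun h : ℝ => Function.update y j h k ^ 2)
      (if k = j then 2 * y j else 0) (y j) := by
    intro k _
    by_cases hk : k = j
    · subst hk
      simpa using hasDerivAt_pow 2 (y k)
    · simpa [hk] using hasDerivAt_const (y j) (y k ^ 2)
  simpa using HasDerivAt.fun_sum h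

theorem hasDerivAt_heisCoord_y {d : ℕ} (w : Heis d) (j : Fin d) : HasDerivAt
    (fun h : ℝ => heisCoord ((Function.update w.1 j h, w.2) : Heis d))
    (2 * Complex.I * w.1 j) (w.1 j) := by
  have h := ((((hasDerivAt_sum_update_sq w.1 j).add_const
    (∑ k, w.2.1 k ^ 2)).ofReal_comp).const_mul Complex.I).const_add (w.2.2 : ℂ)
  refine (h.congr_of_eventuallyEq (.of_forall fun x => ?_)).congr_deriv ?_
  · simp [heisCoord, normYsq, Finset.sum_add_distrib]
  · push_cast; ring

theorem hasDerivAt_heisCoord_eta {d : ℕ} (w : Heis d) (j : Fin d) : HasDerivAt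
    (fun h : ℝ => heisCoord ((w.1, Function.update w.2.1 j h, w.2.2) : Heis d))
    (2 * Complex.I * w.2.1 j) (w.2.1 j) := by
  have h := ((((hasDerivAt_sum_update_sq w.2.1 j).const_add
    (∑ k, w.1 k ^ 2)).ofReal_comp).const_mul Complex.I).const_add (w.2.2 : ℂ)
  refine (h.congr_of_eventuallyEq (.of_forall fun x => ?_)).congr_deriv ?_
  · simp [heisCoord, normYsq, Finset.sum_add_distrib]
  · push_cast; ring

theorem hasDerivAt_heisCoord_s {d : ℕ} (w : Heis d) :
    HasDerivAt (fun h : ℝ => heisCoord ((w.1, w.2.1, h) : Heis d)) 1 w.2.2 := by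
  have h := (hasDerivAt_id w.2.2).ofReal_comp.add_const (Complex.I * normYsq w)
  rwa [Complex.ofReal_one] at h

theorem vfX_comp_heisCoord {d : ℕ} {F : ℂ → ℂ} (hF : Differentiable ℂ F) (j : Fin d) :
    vfX j (fun w => F (heisCoord w)) = fun w =>
      deriv F (heisCoord w) * (2 * Complex.I * w.1 j + 2 * w.2.1 j) := by
  funext w
  have hY := (hF (heisCoord w)).hasDerivAt.comp_of_eq (w.1 j) (hasDerivAt_heisCoord_y w j) (by simp)
  have hS := (hF (heisCoord w)).hasDerivAt.comp_of_eq w.2.2 (hasDerivAt_heisCoord_s w) rfl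
  have hY' : pdY j (fun w => F (heisCoord w)) w = _ := hY.deriv
  have hS' : pdS (fun w => F (heisCoord w)) w = _ := hS.deriv
  rw [vfX, hY', hS']
  ring

theorem vfXi_comp_heisCoord {d : ℕ} {F : ℂ → ℂ} (hF : Differentiable ℂ F) (j : Fin d) :
    vfXi j (fun w => F (heisCoord w)) = fun w =>
      deriv F (heisCoord w) * (2 * Complex.I * w.2.1 j - 2 * w.1 j) := by
  funext w
  have hE := (hF (heisCoord w)).hasDerivAt.comp_of_eq (w.2.1 j) (hasDerivAt_heisCoord_eta w j) (by simp)
  have hS := (hF (heisCoord w)).hasDerivAt.comp_of_eq w.2.2 (hasDerivAt_heisCoord_s w) rfl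
  have hE' : pdEta j (fun w => F (heisCoord w)) w = _ := hE.deriv
  have hS' : pdS (fun w => F (heisCoord w)) w = _ := hS.deriv
  rw [vfXi, hE', hS']
  ring

theorem vfX_comp_heisCoord_mul {d : ℕ} {F : ℂ → ℂ} (hF : Differentiable ℂ F) (j : Fin d)
    (w : Heis d) :
    vfX j (fun w => F (heisCoord w) * (2 * Complex.I * w.1 j + 2 * w.2.1 j)) w =
      deriv F (heisCoord w) * (2 * Complex.I * w.1 j + 2 * w.2.1 j) ^ 2 +
        2 * Complex.I * F (heisCoord w) := by
  have hm : HasDerivAt (fun h : ℝ => 2 * Complex.I * (Function.update w.1 j h j : ℂ) +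
      2 * (w.2.1 j : ℂ)) (2 * Complex.I) (w.1 j) := by
    simpa using ((hasDerivAt_id (w.1 j)).ofReal_comp.const_mul (2 * Complex.I)).add_const
      (2 * (w.2.1 j : ℂ))
  have hY := ((hF (heisCoord w)).hasDerivAt.comp_of_eq (w.1 j) (hasDerivAt_heisCoord_y w j) (by simp)).mul hm
  have hS := ((hF (heisCoord w)).hasDerivAt.comp_of_eq w.2.2 (hasDerivAt_heisCoord_s w) rfl).mul_const
    (2 * Complex.I * w.1 j + 2 * w.2.1 j)
  have hY' : pdY j (fun w => F (heisCoord w) * (2 * Complex.I * w.1 j + 2 * w.2.1 j)) w = _ :=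
    hY.deriv
  have hS' : pdS (fun w => F (heisCoord w) * (2 * Complex.I * w.1 j + 2 * w.2.1 j)) w = _ :=
    hS.deriv
  rw [vfX, hY', hS']
  simp only [Function.comp_apply, Function.update_eq_self]
  change deriv F (heisCoord w) * _ * _ + F (heisCoord w) * _ + _ = _
  ring

theorem vfXi_comp_heisCoord_mul {d : ℕ} {F : ℂ → ℂ} (hF : Differentiable ℂ F) (j : Fin d)
    (w : Heis d) :
    vfXi j (fun w => F (heisCoord w) * (2 * Complex.I * w.2.1 j - 2 * w.1 j)) w =
      deriv F (heisCoord w) * (2 * Complex.I * w.2.1 j - 2 * w.1 j) ^ 2 +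
        2 * Complex.I * F (heisCoord w) := by
  have hm : HasDerivAt (fun h : ℝ => 2 * Complex.I * (Function.update w.2.1 j h j : ℂ) -
      2 * (w.1 j : ℂ)) (2 * Complex.I) (w.2.1 j) := by
    simpa using ((hasDerivAt_id (w.2.1 j)).ofReal_comp.const_mul (2 * Complex.I)).sub_const
      (2 * (w.1 j : ℂ))
  have hE := ((hF (heisCoord w)).hasDerivAt.comp_of_eq (w.2.1 j) (hasDerivAt_heisCoord_eta w j)
    (by simp)).mul hm
  have hS := ((hF (heisCoord w)).hasDerivAt.comp_of_eq w.2.2 (hasDerivAt_heisCoord_s w) rfl).mul_const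
    (2 * Complex.I * w.2.1 j - 2 * w.1 j)
  have hE' : pdEta j (fun w => F (heisCoord w) * (2 * Complex.I * w.2.1 j - 2 * w.1 j)) w = _ :=
    hE.deriv
  have hS' : pdS (fun w => F (heisCoord w) * (2 * Complex.I * w.2.1 j - 2 * w.1 j)) w = _ :=
    hS.deriv
  rw [vfXi, hE', hS']
  simp only [Function.comp_apply, Function.update_eq_self]
  change deriv F (heisCoord w) * _ * _ + F (heisCoord w) * _ - _ = _
  ring

/-- The second-order terms cancel because `Ξ_j (s + i |Y|²) = i X_j (s + i |Y|²)`. -/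
theorem subLap_comp_heisCoord {d : ℕ} {F : ℂ → ℂ} (hF : Differentiable ℂ F) (w : Heis d) :
    subLap (fun w => F (heisCoord w)) w = 4 * Complex.I * d * deriv F (heisCoord w) := by
  have h : ∀ j : Fin d, vfX j (vfX j fun w => F (heisCoord w)) w +
      vfXi j (vfXi j fun w => F (heisCoord w)) w =
        4 * Complex.I * deriv F (heisCoord w) := by
    intro j
    rw [vfX_comp_heisCoord hF, vfXi_comp_heisCoord hF, vfX_comp_heisCoord_mul hF.deriv,
      vfXi_comp_heisCoord_mul hF.deriv]
    linear_combination 4 * deriv (deriv F) (heisCoord w) *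
      ((w.1 j : ℂ) ^ 2 + (w.2.1 j : ℂ) ^ 2) * Complex.I_sq
  simp only [subLap, h, Finset.sum_const, Finset.card_univ, Fintype.card_fin, nsmul_eq_mul]
  ring

/-- for smooth `g` compactly supported in `(0,∞)`, the function
`u(t,Y,s) = u₀(Y, s + 4td)` with `u₀(Y,s) = ∫₀^∞ e^{isλ} e^{-λ|Y|²} g(λ) λ^d dλ`
is a smooth solution of the free Schrödinger equation `i∂ₜu - Δ_ℍ u = 0` with data `u₀`. -/
theorem stmt0 (d : ℕ) (hd : 1 ≤ d) (g : ℝ → ℂ) (hg : ContDiff ℝ (⊤ : ℕ∞) g)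
    (hgc : HasCompactSupport g) (hgs : Function.support g ⊆ Set.Ioi (0 : ℝ)) :
    ∀ (u₀ : Heis d → ℂ) (u : ℝ → Heis d → ℂ),
    (u₀ = fun w => ∫ l in Set.Ioi (0 : ℝ),
        Complex.exp (Complex.I * w.2.2 * l) * Complex.exp (-(l : ℂ) * (normYsq w : ℂ)) *
          g l * (l : ℂ) ^ d) →
    (u = fun t w => u₀ (w.1, w.2.1, w.2.2 + 4 * t * d)) →
      ContDiff ℝ (⊤ : ℕ∞) (fun z : ℝ × Heis d => u z.1 z.2) ∧
      (∀ w, u 0 w = u₀ w) ∧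
      (∀ t w, Complex.I * deriv (fun τ => u τ w) t - subLap (u t) w = 0) := by
  intro u₀ u hu₀ hu
  obtain ⟨F, hF, hFu⟩ : ∃ F : ℂ → ℂ, Differentiable ℂ F ∧ ∀ w, u₀ w = F (heisCoord w) := by
    have hc := hg.continuous
    refine ⟨_, differentiable_integral_exp_mul (φ := fun l => g l * (l : ℂ) ^ d) (by fun_prop)
      hgc.mul_right, fun w => ?_⟩
    rw [hu₀]
    refine integral_congr_ae (.of_forall fun l => ?_)
    simp only
    rw [← Complex.exp_add, mul_assoc]
    congr 2
    rw [heisCoord]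
    linear_combination -(l : ℂ) * normYsq w * Complex.I_sq
  have hut : ∀ t w, u t w = F (heisCoord w + 4 * t * d) := by
    intro t w
    rw [hu]
    simp only [hFu]
    congr 1
    simp only [heisCoord, normYsq]
    push_cast
    ring
  refine ⟨?_, fun w => by simp [hu], fun t w => ?_⟩
  · have hFs : ContDiff ℝ (⊤ : ℕ∞) F := hF.contDiff.restrict_scalars ℝ
    simp only [hut]
    have ht : ContDiff ℝ (⊤ : ℕ∞) (fun z : ℝ × Heis d => (z.1 : ℂ)) :=
      Complex.ofRealCLM.contDiff.comp contDiff_fst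
    exact hFs.comp ((contDiff_heisCoord.comp contDiff_snd).add
      ((contDiff_const.mul ht).mul contDiff_const))
  · have hs : u t = fun w => (fun z => F (z + 4 * t * d)) (heisCoord w) := funext (hut t)
    have hshift : Differentiable ℂ (fun z => F (z + 4 * t * d)) := by fun_prop
    have hτ : HasDerivAt (fun τ : ℝ => heisCoord w + 4 * (τ : ℂ) * d) (4 * d) t := by
      simpa using (((hasDerivAt_id t).ofReal_comp.const_mul (4 : ℂ)).mul_const (d : ℂ)).const_add
        (heisCoord w)
    have ht : deriv (fun τ => u τ w) t = deriv F (heisCoord w + 4 * t * d) * (4 * d) := by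
      simp only [hut]
      exact ((hF _).hasDerivAt.comp t hτ).deriv
    rw [ht, hs, subLap_comp_heisCoord hshift, deriv_comp_add_const]
    ring
end
end

section
/- (Euclidean Strichartz estimate for the Schrödinger equation, endpoint Lebesgue exponent.) Let n ≥ 1. There exists a constant C_n such that for every g ∈ 𝒮(ℝ^n), the function u(t,x) := ∫_{ℝ^n} e^{i(x·ξ + t|ξ|²)} g(ξ) dξ satisfies ‖u‖_{L^{2(n+2)/n}(ℝ×ℝ^n)} ≤ C_n ‖g‖_{L²(ℝ^n)}. -/
noncomputable section

open MeasureTheory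
open scoped ENNReal RealInnerProductSpace

theorem lintegral_comp_abs_le (f : ℝ → ℝ≥0∞) :
    ∫⁻ u : ℝ, f |u| ≤ 2 * ∫⁻ u in Set.Ioi (0 : ℝ), f u := by
  have h0 : ∫⁻ u : ℝ, f |u| =
      (∫⁻ u in Set.Iic (0 : ℝ), f |u|) + ∫⁻ u in Set.Ioi (0 : ℝ), f |u| := by
    rw [← Set.compl_Iic, lintegral_add_compl _ measurableSet_Iic]
  have h1 : ∫⁻ u in Set.Ioi (0 : ℝ), f |u| = ∫⁻ u in Set.Ioi (0 : ℝ), f u :=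
    setLIntegral_congr_fun measurableSet_Ioi fun u hu => by
      simp only [Set.mem_Ioi] at hu; rw [abs_of_pos hu]
  have h2 : ∫⁻ u in Set.Iic (0 : ℝ), f |u| = ∫⁻ u in Set.Ioi (0 : ℝ), f u := by
    rw [setLIntegral_congr (Iio_ae_eq_Iic (a := (0 : ℝ)) (μ := volume)).symm, ← h1]
    have := (Measure.measurePreserving_neg (volume : Measure ℝ)).setLIntegral_comp_preimage_emb
      (MeasurableEquiv.neg ℝ).measurableEmbedding (fun u => f |u|) (Set.Ioi 0)
    rw [← this]
    simp [abs_neg]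
  rw [h0, h1, h2, two_mul]

theorem lintegral_rpow_neg_near {a : ℝ} (ha1 : a < 1) {R : ℝ} (hR : 0 < R) :
    ∫⁻ u : ℝ, (if |u| ≤ R then ‖u‖ₑ ^ (-a) else 0)
      ≤ ENNReal.ofReal (2 / (1 - a) * R ^ (1 - a)) := by
  have h := lintegral_comp_abs_le (fun u => if u ≤ R then ENNReal.ofReal u ^ (-a) else 0)
  have e : ∀ u : ℝ, ‖u‖ₑ = ENNReal.ofReal |u| := fun u => by
    rw [← Real.norm_eq_abs, ofReal_norm]
  simp only [e]
  refine h.trans ?_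
  have hint : IntegrableOn (fun u : ℝ => u ^ (-a)) (Set.Ioc 0 R) := by
    have := intervalIntegral.intervalIntegrable_rpow' (a := 0) (b := R) (r := -a) (by linarith)
    rwa [intervalIntegrable_iff_integrableOn_Ioc_of_le hR.le] at this
  have h1 : ∫⁻ u in Set.Ioi (0 : ℝ), (if u ≤ R then ENNReal.ofReal u ^ (-a) else 0)
      = ENNReal.ofReal (∫ u in Set.Ioc 0 R, u ^ (-a)) := by
    rw [ofReal_integral_eq_lintegral_ofReal hint
      ((ae_restrict_iff' measurableSet_Ioc).2 (ae_of_all _ fun u hu => Real.rpow_nonneg hu.1.le _)),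
      ← lintegral_indicator measurableSet_Ioi, ← lintegral_indicator measurableSet_Ioc]
    congr 1; ext u
    by_cases h0 : 0 < u
    · by_cases h1 : u ≤ R
      · simp [Set.indicator, h0, h1, ENNReal.ofReal_rpow_of_pos h0]
      · simp [Set.indicator, h0, h1]
    · simp [Set.indicator, h0]
  rw [h1, ← intervalIntegral.integral_of_le hR.le, integral_rpow (Or.inl (by linarith)),
    Real.zero_rpow (by linarith), ← ENNReal.ofReal_ofNat, ← ENNReal.ofReal_mul (by norm_num)]
  apply le_of_eq; congr 1
  rw [show -a + 1 = 1 - a by ring]; ring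

theorem lintegral_inv_sq_far {R : ℝ} (hR : 0 < R) :
    ∫⁻ u : ℝ, (if |u| ≤ R then 0 else ‖u‖ₑ ^ (-2 : ℝ)) ≤ ENNReal.ofReal (2 / R) := by
  have h := lintegral_comp_abs_le (fun u => if u ≤ R then 0 else ENNReal.ofReal u ^ (-2 : ℝ))
  have e : ∀ u : ℝ, ‖u‖ₑ = ENNReal.ofReal |u| := fun u => by
    rw [← Real.norm_eq_abs, ofReal_norm]
  simp only [e]
  refine h.trans ?_
  have hint := integrableOn_Ioi_rpow_of_lt (a := -2) (by norm_num) hR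
  have h1 : ∫⁻ u in Set.Ioi (0 : ℝ), (if u ≤ R then 0 else ENNReal.ofReal u ^ (-2 : ℝ))
      = ENNReal.ofReal (∫ u in Set.Ioi R, u ^ (-2 : ℝ)) := by
    rw [ofReal_integral_eq_lintegral_ofReal hint
      ((ae_restrict_iff' measurableSet_Ioi).2 (ae_of_all _ fun u hu =>
        Real.rpow_nonneg (hR.trans hu).le _)),
      ← lintegral_indicator measurableSet_Ioi, ← lintegral_indicator measurableSet_Ioi]
    congr 1; ext u
    by_cases h1 : u ≤ R
    · simp [Set.indicator, h1]
    · have h0 : 0 < u := by linarith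
      have h2 : R < u := by linarith
      simp only [Set.indicator, Set.mem_Ioi, h0, h2, h1, if_true, if_false]
      rw [ENNReal.ofReal_rpow_of_pos h0]
  rw [h1, integral_Ioi_rpow_of_lt (by norm_num) hR, ← ENNReal.ofReal_ofNat,
    ← ENNReal.ofReal_mul (by norm_num)]
  apply le_of_eq; congr 1
  norm_num [Real.rpow_neg_one]; ring

/-- Pointwise bound for the fractional integral of the truncation of `φ` at its value at `t`. -/
theorem lintegral_truncated_riesz_le {a p : ℝ} (ha0 : 0 < a) (ha1 : a < 1) (hp : p = 2 / (2 - a))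
    {φ : ℝ → ℝ≥0∞} (hφ : Measurable φ) {N : ℝ} (hN : 0 < N)
    (hX : ∫⁻ s, φ s ^ p = ENNReal.ofReal (N ^ p)) {t x : ℝ} (hx : 0 < x)
    (hφt : φ t = ENNReal.ofReal x) :
    ∫⁻ s, (if φ s ≤ φ t then φ s else 0) * ‖t - s‖ₑ ^ (-a)
      ≤ ENNReal.ofReal ((2 / (1 - a) + 2 ^ (a / 2)) * (x ^ (p - 1) * N ^ (2 - p))) := by
  have h2a : 0 < 2 - a := by linarith
  have hp1 : 1 < p := by rw [hp, lt_div_iff₀ h2a]; linarith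
  set R : ℝ := (N / x) ^ p with hRdef
  have hR : 0 < R := Real.rpow_pos_of_pos (div_pos hN hx) _
  have hk : Measurable fun s : ℝ => ‖t - s‖ₑ ^ (-a) := by fun_prop
  have hset : MeasurableSet {s : ℝ | |t - s| ≤ R} :=
    measurableSet_le (by fun_prop) measurable_const
  have hbound : ∀ s, (if φ s ≤ φ t then φ s else 0) * ‖t - s‖ₑ ^ (-a)
      ≤ φ t * (if |t - s| ≤ R then ‖t - s‖ₑ ^ (-a) else 0)
        + φ s * (if |t - s| ≤ R then 0 else ‖t - s‖ₑ ^ (-a)) := by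
    intro s
    by_cases h1 : |t - s| ≤ R <;> by_cases h2 : φ s ≤ φ t <;> simp [h1, h2]
    gcongr
  have hnear : ∫⁻ s, (if |t - s| ≤ R then ‖t - s‖ₑ ^ (-a) else 0)
      ≤ ENNReal.ofReal (2 / (1 - a) * R ^ (1 - a)) := by
    rw [lintegral_sub_left_eq_self (fun u : ℝ => if |u| ≤ R then ‖u‖ₑ ^ (-a) else 0) t]
    exact lintegral_rpow_neg_near ha1 hR
  have hfar : ∫⁻ s, φ s * (if |t - s| ≤ R then 0 else ‖t - s‖ₑ ^ (-a))
      ≤ ENNReal.ofReal (N * (2 / R) ^ (a / 2)) := by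
    have hpq : p.HolderConjugate (2 / a) := by
      rw [Real.holderConjugate_iff]
      refine ⟨hp1, ?_⟩
      rw [hp]; field_simp; ring
    have := ENNReal.lintegral_mul_le_Lp_mul_Lq volume hpq (f := φ)
      (g := fun s => if |t - s| ≤ R then 0 else ‖t - s‖ₑ ^ (-a)) hφ.aemeasurable
      (Measurable.ite hset measurable_const hk).aemeasurable
    refine this.trans ?_
    rw [hX]
    have e : ∀ s : ℝ, (if |t - s| ≤ R then 0 else ‖t - s‖ₑ ^ (-a)) ^ (2 / a)
        = if |t - s| ≤ R then 0 else ‖t - s‖ₑ ^ (-2 : ℝ) := by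
      intro s
      split_ifs
      · rw [ENNReal.zero_rpow_of_pos (by positivity)]
      · rw [← ENNReal.rpow_mul]; congr 1; field_simp
    simp only [e]
    rw [lintegral_sub_left_eq_self (fun u : ℝ => if |u| ≤ R then 0 else ‖u‖ₑ ^ (-2 : ℝ)) t,
      ENNReal.ofReal_rpow_of_pos (by positivity), ← Real.rpow_mul hN.le,
      mul_one_div_cancel (by linarith), Real.rpow_one,
      ENNReal.ofReal_mul hN.le]
    gcongr
    refine (ENNReal.rpow_le_rpow (lintegral_inv_sq_far hR) (by positivity)).trans ?_
    rw [ENNReal.ofReal_rpow_of_pos (by positivity), one_div_div]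
  calc _ ≤ ∫⁻ s, (φ t * (if |t - s| ≤ R then ‖t - s‖ₑ ^ (-a) else 0)
        + φ s * (if |t - s| ≤ R then 0 else ‖t - s‖ₑ ^ (-a))) := lintegral_mono hbound
    _ = φ t * (∫⁻ s, (if |t - s| ≤ R then ‖t - s‖ₑ ^ (-a) else 0))
        + ∫⁻ s, φ s * (if |t - s| ≤ R then 0 else ‖t - s‖ₑ ^ (-a)) := by
      rw [lintegral_add_left, lintegral_const_mul]
      · exact Measurable.ite hset hk measurable_const
      · exact (Measurable.ite hset hk measurable_const).const_mul _
    _ ≤ ENNReal.ofReal x * ENNReal.ofReal (2 / (1 - a) * R ^ (1 - a))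
        + ENNReal.ofReal (N * (2 / R) ^ (a / 2)) := by
      rw [hφt]; gcongr
    _ = ENNReal.ofReal (x * (2 / (1 - a) * R ^ (1 - a)) + N * (2 / R) ^ (a / 2)) := by
      have : 0 < 1 - a := by linarith
      rw [← ENNReal.ofReal_mul hx.le, ← ENNReal.ofReal_add (by positivity) (by positivity)]
    _ = _ := by
      congr 1
      have e1 : R ^ (1 - a) = N ^ (2 - p) / x ^ (2 - p) := by
        rw [hRdef, ← Real.rpow_mul (by positivity), ← Real.div_rpow hN.le hx.le]
        congr 1; rw [hp]; field_simp; ring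
      have e2 : (2 / R) ^ (a / 2) = 2 ^ (a / 2) * (x ^ (p - 1) / N ^ (p - 1)) := by
        rw [Real.div_rpow (by norm_num) hR.le, hRdef, ← Real.rpow_mul (by positivity),
          ← Real.div_rpow hx.le hN.le, div_eq_mul_inv, ← Real.inv_rpow (by positivity), inv_div]
        congr 2; rw [hp]; field_simp; ring
      rw [e1, e2]
      have e3 : x ^ (p - 1) * x ^ (2 - p) = x := by rw [← Real.rpow_add hx]; norm_num
      have e4 : N ^ (p - 1) * N ^ (2 - p) = N := by rw [← Real.rpow_add hN]; norm_num
      have := Real.rpow_pos_of_pos hx (p - 1)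
      have := Real.rpow_pos_of_pos hx (2 - p)
      have := Real.rpow_pos_of_pos hN (p - 1)
      have := Real.rpow_pos_of_pos hN (2 - p)
      have e5 : x * (N ^ (2 - p) / x ^ (2 - p)) = x ^ (p - 1) * N ^ (2 - p) := by
        rw [← mul_div_assoc, div_eq_iff (by positivity)]
        nth_rewrite 1 [← e3]; ring
      have e6 : N * (x ^ (p - 1) / N ^ (p - 1)) = x ^ (p - 1) * N ^ (2 - p) := by
        rw [← mul_div_assoc, div_eq_iff (by positivity)]
        nth_rewrite 1 [← e4]; ring
      linear_combination (2 / (1 - a)) * e5 + 2 ^ (a / 2) * e6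

/-- Diagonal Hardy-Littlewood-Sobolev inequality on the line. -/
theorem hardy_littlewood_sobolev {a p : ℝ} (ha0 : 0 < a) (ha1 : a < 1) (hp : p = 2 / (2 - a))
    {φ : ℝ → ℝ≥0∞} (hφ : Measurable φ) (hX : ∫⁻ s, φ s ^ p ≠ ∞) :
    ∫⁻ t, ∫⁻ s, φ t * φ s * ‖t - s‖ₑ ^ (-a)
      ≤ ENNReal.ofReal (2 * (2 / (1 - a) + 2 ^ (a / 2))) * (∫⁻ s, φ s ^ p) ^ (2 / p) := by
  have h2a : 0 < 2 - a := by linarith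
  have hp1 : 1 < p := by rw [hp, lt_div_iff₀ h2a]; linarith
  have hp0 : 0 < p := by linarith
  rcases eq_or_ne (∫⁻ s, φ s ^ p) 0 with h0 | h0
  · have hz : ∀ᵐ s, φ s = 0 := by
      rw [lintegral_eq_zero_iff (hφ.pow_const _)] at h0
      filter_upwards [h0] with s hs
      simpa [hp0, hp0.le, not_lt.2 hp0.le] using hs
    have : ∫⁻ t, ∫⁻ s, φ t * φ s * ‖t - s‖ₑ ^ (-a) = 0 := by
      rw [lintegral_congr_ae (g := fun _ => 0)]
      · simp
      · filter_upwards [hz] with t ht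
        simp [ht]
    rw [this]; exact zero_le
  set X := ∫⁻ s, φ s ^ p with hXdef
  set N : ℝ := X.toReal ^ (1 / p) with hNdef
  have hXpos : 0 < X.toReal := ENNReal.toReal_pos h0 hX
  have hN : 0 < N := Real.rpow_pos_of_pos hXpos _
  have hNp : X = ENNReal.ofReal (N ^ p) := by
    rw [hNdef, ← Real.rpow_mul hXpos.le, one_div_mul_cancel hp0.ne', Real.rpow_one,
      ENNReal.ofReal_toReal hX]
  set T : ℝ → ℝ → ℝ≥0∞ := fun t s =>
    φ t * ((if φ s ≤ φ t then φ s else 0) * ‖t - s‖ₑ ^ (-a)) with hT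
  have hTm : Measurable (Function.uncurry T) := by
    refine (hφ.comp measurable_fst).mul (Measurable.mul (Measurable.ite ?_ ?_ measurable_const) ?_)
    · exact measurableSet_le (hφ.comp measurable_snd) (hφ.comp measurable_fst)
    · exact hφ.comp measurable_snd
    · fun_prop
  have hbound : ∀ t s, φ t * φ s * ‖t - s‖ₑ ^ (-a) ≤ T t s + T s t := by
    intro t s
    rcases le_total (φ s) (φ t) with h | h
    · refine le_trans (le_of_eq ?_) le_self_add
      simp only [hT, if_pos h]; ring
    · refine le_trans (le_of_eq ?_) le_add_self
      simp only [hT, if_pos h]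
      rw [← enorm_neg (t - s), neg_sub]; ring
  have hfin : ∀ᵐ t, φ t < ∞ := by
    filter_upwards [ae_lt_top (hφ.pow_const p) hX] with t ht
    by_contra hc
    simp only [not_lt, top_le_iff] at hc
    simp [hc, ENNReal.top_rpow_of_pos hp0] at ht
  set K := 2 / (1 - a) + 2 ^ (a / 2) with hK
  have hKpos : 0 < K := by
    have : 0 < 1 - a := by linarith
    positivity
  have hmain : ∫⁻ t, ∫⁻ s, T t s ≤ ENNReal.ofReal K * X ^ (2 / p) := by
    calc _ ≤ ∫⁻ t, ENNReal.ofReal (K * N ^ (2 - p)) * φ t ^ p := by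
          refine lintegral_mono_ae ?_
          filter_upwards [hfin] with t ht
          rcases eq_or_ne (φ t) 0 with hz | hz
          · simp [hT, hz]
          have hx : 0 < (φ t).toReal := ENNReal.toReal_pos hz ht.ne
          have hxt : φ t = ENNReal.ofReal (φ t).toReal := (ENNReal.ofReal_toReal ht.ne).symm
          have := lintegral_truncated_riesz_le ha0 ha1 hp hφ hN hNp hx hxt
          simp only [hT]
          rw [lintegral_const_mul' _ _ ht.ne]
          refine (mul_le_mul_right this _).trans (le_of_eq ?_)
          rw [hxt, ENNReal.toReal_ofReal hx.le, ENNReal.ofReal_rpow_of_pos hx,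
            ← ENNReal.ofReal_mul hx.le, ← ENNReal.ofReal_mul (by positivity)]
          congr 1
          have : (φ t).toReal ^ p = (φ t).toReal * (φ t).toReal ^ (p - 1) := by
            rw [← Real.rpow_one_add' hx.le (by linarith)]; congr 1; ring
          rw [this]; ring
      _ = ENNReal.ofReal (K * N ^ (2 - p)) * X := by
          rw [lintegral_const_mul _ (hφ.pow_const p)]
      _ = _ := by
          rw [hNp, ENNReal.ofReal_rpow_of_pos (by positivity), ← Real.rpow_mul hN.le,
            ← ENNReal.ofReal_mul (by positivity), ← ENNReal.ofReal_mul (by positivity),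
            mul_assoc, ← Real.rpow_add hN]
          congr 3
          field_simp; ring
  calc _ ≤ ∫⁻ t, ∫⁻ s, (T t s + T s t) :=
        lintegral_mono fun t => lintegral_mono fun s => hbound t s
    _ = (∫⁻ t, ∫⁻ s, T t s) + ∫⁻ t, ∫⁻ s, T s t := by
        rw [← lintegral_add_left (f := fun t => ∫⁻ s, T t s) hTm.lintegral_prod_right']
        refine lintegral_congr fun t => 
      lintegral_add_left (f := fun s => T t s) (hTm.comp measurable_prodMk_left) _
    _ = 2 * ∫⁻ t, ∫⁻ s, T t s := by
        rw [lintegral_lintegral_swap (f := fun t s => T s t), two_mul]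
        exact (hTm.comp measurable_swap).aemeasurable
    _ ≤ _ := by
        rw [ENNReal.ofReal_mul (by norm_num), ENNReal.ofReal_ofNat, mul_assoc]
        gcongr
/-- The unit-length logarithmic window of levels `σ` attached to a norm `r`. -/
def levelWindow (r : ℝ) : Set ℝ := {σ | Real.exp (σ - 1) < r ∧ r ≤ Real.exp σ}

theorem levelWindow_eq {r : ℝ} (hr : 0 < r) :
    levelWindow r = Set.Ico (Real.log r) (Real.log r + 1) := by
  ext σ
  simp only [levelWindow, Set.mem_ofPred_eq, Set.mem_Ico, ← Real.lt_log_iff_exp_lt hr,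
    ← Real.log_le_iff_le_exp hr]
  constructor <;> rintro ⟨h1, h2⟩ <;> constructor <;> linarith

theorem measurableSet_levelWindow {α : Type*} [MeasurableSpace α] {h : α → ℂ} (hh : Measurable h) :
    MeasurableSet {z : α × ℝ | z.2 ∈ levelWindow ‖h z.1‖} := by
  have h1 : Measurable fun z : α × ℝ => ‖h z.1‖ := (hh.comp measurable_fst).norm
  exact (measurableSet_lt (by fun_prop) h1).inter (measurableSet_le h1 (by fun_prop))

theorem volume_levelWindow {r : ℝ} (hr : 0 < r) : volume (levelWindow r) = 1 := by
  rw [levelWindow_eq hr]; simp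

theorem measurableSet_levelWindow' (r : ℝ) : MeasurableSet (levelWindow r) := by
  have h1 : MeasurableSet {σ : ℝ | Real.exp (σ - 1) < r} :=
    measurableSet_lt (by fun_prop) measurable_const
  have h2 : MeasurableSet {σ : ℝ | r ≤ Real.exp σ} :=
    measurableSet_le measurable_const (by fun_prop)
  exact h1.inter h2

theorem lintegral_indicator_levelWindow_le (r : ℝ) (c : ℝ≥0∞) :
    ∫⁻ σ, (levelWindow r).indicator (fun _ => c) σ ≤ c := by
  rw [lintegral_indicator_const (measurableSet_levelWindow' r)]
  rcases le_or_gt r 0 with hr | hr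
  · have : levelWindow r = ∅ := by
      ext σ
      simp only [levelWindow, Set.mem_ofPred_eq, Set.mem_empty_iff_false, iff_false, not_and]
      intro h
      linarith [Real.exp_pos (σ - 1)]
    simp [this]
  · simp [volume_levelWindow hr]

theorem integral_indicator_levelWindow {r : ℝ} (hr : 0 < r) (c : ℂ) :
    ∫ σ, (levelWindow r).indicator (fun _ => c) σ = c := by
  rw [integral_indicator_const _ (measurableSet_levelWindow' r), measureReal_def,
    volume_levelWindow hr]
  simp

/-- Slice of `h` at logarithmic level `σ`. -/
def levelSlice {α : Type*} (h : α → ℂ) (σ : ℝ) (y : α) : ℂ :=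
  (levelWindow ‖h y‖).indicator (fun _ => h y) σ

theorem measurable_levelSlice {α : Type*} [MeasurableSpace α] {h : α → ℂ} (hh : Measurable h) :
    Measurable fun z : α × ℝ => levelSlice h z.2 z.1 := by
  have := (hh.comp (measurable_fst (β := ℝ))).indicator (measurableSet_levelWindow hh)
  exact this

theorem integral_levelSlice {α : Type*} (h : α → ℂ) (y : α) : ∫ σ, levelSlice h σ y = h y := by
  rcases eq_or_ne (h y) 0 with h0 | h0
  · simp [levelSlice, h0]
  · exact integral_indicator_levelWindow (norm_pos_iff.2 h0) _

theorem enorm_levelSlice {α : Type*} (h : α → ℂ) (σ : ℝ) (y : α) :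
    ‖levelSlice h σ y‖ₑ = (levelWindow ‖h y‖).indicator (fun _ => ‖h y‖ₑ) σ := by
  rw [levelSlice, enorm_indicator_eq_indicator_enorm]

theorem lintegral_levelSlice_le {α : Type*} (h : α → ℂ) (y : α) :
    ∫⁻ σ, ‖levelSlice h σ y‖ₑ ≤ ‖h y‖ₑ := by
  simp only [enorm_levelSlice]
  exact lintegral_indicator_levelWindow_le _ _

/-- The part of `f` below the threshold `l * exp (-σ)`. -/
def lowPart {α : Type*} (f : α → ℂ) (l σ : ℝ) (x : α) : ℂ :=
  if ‖f x‖ * Real.exp σ ≤ l then f x else 0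

/-- The part of `f` above the threshold `l * exp (-σ)`. -/
def highPart {α : Type*} (f : α → ℂ) (l σ : ℝ) (x : α) : ℂ :=
  if ‖f x‖ * Real.exp σ ≤ l then 0 else f x

theorem measurable_lowPart {α : Type*} [MeasurableSpace α] {f : α → ℂ} (hf : Measurable f)
    (l : ℝ) : Measurable fun z : α × ℝ => lowPart f l z.2 z.1 := by
  have h1 : Measurable fun z : α × ℝ => ‖f z.1‖ := (hf.comp measurable_fst).norm
  exact Measurable.ite (measurableSet_le (h1.mul (by fun_prop)) measurable_const)
    (hf.comp measurable_fst) measurable_const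

theorem measurable_highPart {α : Type*} [MeasurableSpace α] {f : α → ℂ} (hf : Measurable f)
    (l : ℝ) : Measurable fun z : α × ℝ => highPart f l z.2 z.1 := by
  have h1 : Measurable fun z : α × ℝ => ‖f z.1‖ := (hf.comp measurable_fst).norm
  exact Measurable.ite (measurableSet_le (h1.mul (by fun_prop)) measurable_const)
    measurable_const (hf.comp measurable_fst)

theorem lowPart_add_highPart {α : Type*} (f : α → ℂ) (l σ : ℝ) (x : α) :
    lowPart f l σ x + highPart f l σ x = f x := by
  unfold lowPart highPart; split_ifs <;> simp

theorem enorm_highPart_mul_levelSlice_le {α : Type*} (f h : α → ℂ) {l p : ℝ} (hl : 0 < l)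
    (hp1 : 1 < p) (σ : ℝ) (x y : α) :
    ‖highPart f l σ x‖ₑ * ‖levelSlice h σ y‖ₑ ≤ (levelWindow ‖h y‖).indicator
      (fun _ => ENNReal.ofReal ((l / Real.exp 1) ^ (1 - p)) * (‖f x‖ₑ ^ p * ‖h y‖ₑ ^ p)) σ := by
  rw [enorm_levelSlice]
  by_cases hσ : σ ∈ levelWindow ‖h y‖
  swap
  · simp [hσ]
  simp only [Set.indicator_of_mem hσ]
  unfold highPart
  split_ifs with hlow
  · simp
  have hf : 0 < ‖f x‖ := by
    by_contra hc
    apply hlow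
    have : ‖f x‖ = 0 := le_antisymm (not_lt.1 hc) (norm_nonneg _)
    rw [this]; simpa using hl.le
  have hh : 0 < ‖h y‖ := (Real.exp_pos _).trans hσ.1
  have key : l / Real.exp 1 ≤ ‖f x‖ * ‖h y‖ := by
    rw [div_le_iff₀ (Real.exp_pos 1)]
    have h1 : Real.exp σ = Real.exp (σ - 1) * Real.exp 1 := by rw [← Real.exp_add]; ring_nf
    have h2 := hσ.1
    have : ‖f x‖ * Real.exp σ ≤ ‖f x‖ * (‖h y‖ * Real.exp 1) := by
      rw [h1]; gcongr
    linarith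
  rw [← ofReal_norm, ← ofReal_norm, ENNReal.ofReal_rpow_of_pos hf, ENNReal.ofReal_rpow_of_pos hh,
    ← ENNReal.ofReal_mul hf.le, ← ENNReal.ofReal_mul (by positivity),
    ← ENNReal.ofReal_mul (by positivity), ← Real.mul_rpow hf.le hh.le]
  apply ENNReal.ofReal_le_ofReal
  have hpos : 0 < ‖f x‖ * ‖h y‖ := by positivity
  calc ‖f x‖ * ‖h y‖ = (‖f x‖ * ‖h y‖) ^ (1 - p) * (‖f x‖ * ‖h y‖) ^ p := by
        rw [← Real.rpow_add hpos]; simp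
    _ ≤ _ := by
        gcongr ?_ * _
        exact Real.rpow_le_rpow_of_nonpos (by positivity) key (by linarith)

theorem lintegral_exp_mul_levelSlice_le {α : Type*} (h : α → ℂ) {p : ℝ} (hp2 : p < 2) (y : α) :
    ∫⁻ σ, ENNReal.ofReal (Real.exp (-((2 - p) * σ))) * ‖levelSlice h σ y‖ₑ ^ (2 : ℝ)
      ≤ ‖h y‖ₑ ^ p := by
  refine le_trans (lintegral_mono fun σ => ?_)
    (lintegral_indicator_levelWindow_le ‖h y‖ (‖h y‖ₑ ^ p))
  rw [enorm_levelSlice]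
  by_cases hσ : σ ∈ levelWindow ‖h y‖
  swap
  · simp [hσ]
  simp only [Set.indicator_of_mem hσ]
  have hh : 0 < ‖h y‖ := (Real.exp_pos _).trans hσ.1
  rw [← ofReal_norm, ENNReal.ofReal_rpow_of_pos hh, ENNReal.ofReal_rpow_of_pos hh,
    ← ENNReal.ofReal_mul (Real.exp_pos _).le]
  apply ENNReal.ofReal_le_ofReal
  have h1 : Real.exp (-((2 - p) * σ)) = (Real.exp σ) ^ (-(2 - p)) := by
    rw [← Real.exp_mul]; ring_nf
  calc _ ≤ ‖h y‖ ^ (-(2 - p)) * ‖h y‖ ^ (2 : ℝ) := by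
        rw [h1]
        gcongr ?_ * _
        exact Real.rpow_le_rpow_of_nonpos hh hσ.2 (by linarith)
    _ = _ := by rw [← Real.rpow_add hh]; congr 1; ring

theorem lintegral_exp_mul_lowPart_le {α : Type*} (f : α → ℂ) {l p : ℝ} (hl : 0 < l)
    (hp2 : p < 2) (x : α) :
    ∫⁻ σ, ENNReal.ofReal (Real.exp ((2 - p) * σ)) * ‖lowPart f l σ x‖ₑ ^ (2 : ℝ)
      ≤ ENNReal.ofReal (l ^ (2 - p) / (2 - p)) * ‖f x‖ₑ ^ p := by
  rcases eq_or_ne (f x) 0 with h0 | h0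
  · simp [lowPart, h0]
  have hf : 0 < ‖f x‖ := norm_pos_iff.2 h0
  have h2p : 0 < 2 - p := by linarith
  have e : ∀ σ, ENNReal.ofReal (Real.exp ((2 - p) * σ)) * ‖lowPart f l σ x‖ₑ ^ (2 : ℝ)
      = (Set.Iic (Real.log (l / ‖f x‖))).indicator
        (fun σ => ENNReal.ofReal (Real.exp ((2 - p) * σ)) * ‖f x‖ₑ ^ (2 : ℝ)) σ := by
    intro σ
    have : ‖f x‖ * Real.exp σ ≤ l ↔ σ ∈ Set.Iic (Real.log (l / ‖f x‖)) := by
      rw [Set.mem_Iic, Real.le_log_iff_exp_le (by positivity), le_div_iff₀ hf, mul_comm]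
    by_cases hσ : σ ∈ Set.Iic (Real.log (l / ‖f x‖))
    · rw [Set.indicator_of_mem hσ, lowPart, if_pos (this.2 hσ)]
    · rw [Set.indicator_of_notMem hσ, lowPart, if_neg (fun hc => hσ (this.1 hc))]; simp
  simp only [e]
  rw [lintegral_indicator measurableSet_Iic, lintegral_mul_const _ (by fun_prop),
    ← ofReal_integral_eq_lintegral_ofReal (integrableOn_exp_mul_Iic h2p _)
      (ae_of_all _ fun _ => (Real.exp_pos _).le), integral_exp_mul_Iic h2p,
    ← ofReal_norm, ENNReal.ofReal_rpow_of_pos hf, ENNReal.ofReal_rpow_of_pos hf,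
    ← ENNReal.ofReal_mul (by positivity), ← ENNReal.ofReal_mul (by positivity)]
  apply ENNReal.ofReal_le_ofReal
  have h1 : Real.exp ((2 - p) * Real.log (l / ‖f x‖)) = l ^ (2 - p) / ‖f x‖ ^ (2 - p) := by
    rw [mul_comm, ← Real.rpow_def_of_pos (by positivity), Real.div_rpow hl.le hf.le]
  have h2 : ‖f x‖ ^ (2 : ℝ) = ‖f x‖ ^ (2 - p) * ‖f x‖ ^ p := by
    rw [← Real.rpow_add hf]; congr 1; ring
  rw [h1, h2]
  apply le_of_eq
  have := Real.rpow_pos_of_pos hf (2 - p)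
  field_simp

theorem integrable_mul_mul_kernel {α : Type*} [MeasurableSpace α] {μ : Measure α}
    {k : α × α → ℂ} (hk : Measurable k) {A : ℝ}
    (hA : ∀ z, ‖k z‖ ≤ A) {f h : α → ℂ} (hfi : Integrable f μ) (hhi : Integrable h μ) :
    Integrable (fun z : α × α => f z.1 * h z.2 * k z) (μ.prod μ) :=
  (hfi.mul_prod hhi).mul_bdd hk.aestronglyMeasurable (ae_of_all _ hA)

theorem measurable_highPart_mul_levelSlice {α : Type*} [MeasurableSpace α]
    {k : α × α → ℂ} (hk : Measurable k) {f h : α → ℂ} (hf : Measurable f) (hh : Measurable h)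
    (l : ℝ) : Measurable fun w : ℝ × (α × α) =>
      ‖highPart f l w.1 w.2.1‖ₑ * ‖levelSlice h w.1 w.2.2‖ₑ * ‖k w.2‖ₑ := by
  refine Measurable.mul (Measurable.mul ?_ ?_) (hk.enorm.comp measurable_snd)
  · exact (measurable_highPart hf l).enorm.comp (g := fun z : α × ℝ => ‖highPart f l z.2 z.1‖ₑ)
      (f := fun w : ℝ × (α × α) => (w.2.1, w.1)) (by fun_prop)
  · exact (measurable_levelSlice hh).enorm.comp (g := fun z : α × ℝ => ‖levelSlice h z.2 z.1‖ₑ)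
      (f := fun w : ℝ × (α × α) => (w.2.2, w.1)) (by fun_prop)

theorem lintegral_highPart_mul_levelSlice_le {α : Type*} [MeasurableSpace α] {μ : Measure α}
    [SFinite μ]
    {k : α × α → ℂ} (hk : Measurable k)
    {A : ℝ} (hA : ∀ z, ‖k z‖ ≤ A) {p : ℝ} (hp1 : 1 < p) {f h : α → ℂ} (hf : Measurable f)
    (hh : Measurable h) {l : ℝ} (hl : 0 < l) :
    ∫⁻ σ, ∫⁻ z, ‖highPart f l σ z.1‖ₑ * ‖levelSlice h σ z.2‖ₑ * ‖k z‖ₑ ∂μ.prod μ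
      ≤ ENNReal.ofReal A * (ENNReal.ofReal ((l / Real.exp 1) ^ (1 - p)) *
          ((∫⁻ x, ‖f x‖ₑ ^ p ∂μ) * ∫⁻ x, ‖h x‖ₑ ^ p ∂μ)) := by
  have hkA : ∀ z, ‖k z‖ₑ ≤ ENNReal.ofReal A := fun z => by
    rw [← ofReal_norm]; exact ENNReal.ofReal_le_ofReal (hA z)
  rw [lintegral_lintegral_swap (measurable_highPart_mul_levelSlice hk hf hh l).aemeasurable]
  have hpt : ∀ z : α × α, ∫⁻ σ, ‖highPart f l σ z.1‖ₑ * ‖levelSlice h σ z.2‖ₑ * ‖k z‖ₑ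
      ≤ (ENNReal.ofReal ((l / Real.exp 1) ^ (1 - p)) * (‖f z.1‖ₑ ^ p * ‖h z.2‖ₑ ^ p))
        * ENNReal.ofReal A := by
    intro z
    rw [lintegral_mul_const' _ _ enorm_ne_top]
    gcongr
    · exact (lintegral_mono fun σ => enorm_highPart_mul_levelSlice_le f h hl hp1 σ z.1 z.2).trans
        (lintegral_indicator_levelWindow_le _ _)
    · exact hkA z
  refine (lintegral_mono hpt).trans (le_of_eq ?_)
  rw [lintegral_mul_const _ (by fun_prop), lintegral_const_mul _ (by fun_prop),
    lintegral_prod_mul (f := fun x => ‖f x‖ₑ ^ p) (g := fun x => ‖h x‖ₑ ^ p)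
      (by fun_prop) (by fun_prop), mul_comm]

theorem lintegral_lowPart_mul_levelSlice_le {α : Type*} [MeasurableSpace α] {μ : Measure α}
    [SFinite μ]
    {p : ℝ} (hp2 : p < 2) {f h : α → ℂ}
    (hf : Measurable f) (hh : Measurable h) {l : ℝ} (hl : 0 < l) :
    ∫⁻ σ, (∫⁻ x, ‖lowPart f l σ x‖ₑ ^ (2 : ℝ) ∂μ) ^ (1 / 2 : ℝ)
          * (∫⁻ x, ‖levelSlice h σ x‖ₑ ^ (2 : ℝ) ∂μ) ^ (1 / 2 : ℝ)
      ≤ (ENNReal.ofReal (l ^ (2 - p) / (2 - p)) * ∫⁻ x, ‖f x‖ₑ ^ p ∂μ) ^ (1 / 2 : ℝ)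
          * (∫⁻ x, ‖h x‖ₑ ^ p ∂μ) ^ (1 / 2 : ℝ) := by
  have hPm : Measurable fun w : ℝ × α => ENNReal.ofReal (Real.exp ((2 - p) * w.1))
      * ‖lowPart f l w.1 w.2‖ₑ ^ (2 : ℝ) := by
    have h1 : Measurable fun w : ℝ × α => lowPart f l w.1 w.2 :=
      (measurable_lowPart hf l).comp measurable_swap
    fun_prop
  have hQm : Measurable fun w : ℝ × α => ENNReal.ofReal (Real.exp (-((2 - p) * w.1)))
      * ‖levelSlice h w.1 w.2‖ₑ ^ (2 : ℝ) := by
    have h1 : Measurable fun w : ℝ × α => levelSlice h w.1 w.2 :=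
      (measurable_levelSlice hh).comp measurable_swap
    fun_prop
  have hcs := ENNReal.lintegral_mul_norm_pow_le (μ := (volume : Measure ℝ))
    (f := fun σ => ∫⁻ x, ENNReal.ofReal (Real.exp ((2 - p) * σ))
      * ‖lowPart f l σ x‖ₑ ^ (2 : ℝ) ∂μ)
    (g := fun σ => ∫⁻ x, ENNReal.ofReal (Real.exp (-((2 - p) * σ)))
      * ‖levelSlice h σ x‖ₑ ^ (2 : ℝ) ∂μ)
    hPm.lintegral_prod_right'.aemeasurable hQm.lintegral_prod_right'.aemeasurable
    (p := 1 / 2) (q := 1 / 2) (by norm_num) (by norm_num) (by norm_num)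
  refine le_trans (le_of_eq (lintegral_congr fun σ => ?_)) (hcs.trans ?_)
  · rw [lintegral_const_mul' _ _ ENNReal.ofReal_ne_top,
      lintegral_const_mul' _ _ ENNReal.ofReal_ne_top,
      ENNReal.mul_rpow_of_nonneg _ _ (by norm_num), ENNReal.mul_rpow_of_nonneg _ _ (by norm_num),
      mul_mul_mul_comm,
      ← ENNReal.mul_rpow_of_nonneg (ENNReal.ofReal _) (ENNReal.ofReal _) (by norm_num),
      ← ENNReal.ofReal_mul (Real.exp_pos _).le, ← Real.exp_add]
    simp
  · rw [lintegral_lintegral_swap (f := fun σ x => ENNReal.ofReal (Real.exp ((2 - p) * σ))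
      * ‖lowPart f l σ x‖ₑ ^ (2 : ℝ)) hPm.aemeasurable,
      lintegral_lintegral_swap (f := fun σ x => ENNReal.ofReal (Real.exp (-((2 - p) * σ)))
      * ‖levelSlice h σ x‖ₑ ^ (2 : ℝ)) hQm.aemeasurable]
    gcongr
    · rw [← lintegral_const_mul _ (by fun_prop)]
      exact lintegral_mono fun x => lintegral_exp_mul_lowPart_le f hl hp2 x
    · exact lintegral_exp_mul_levelSlice_le h hp2 _

/-- Real interpolation between an `L¹ × L¹` bound and an `L² × L²` bound for a bilinear form,
with a free threshold `l`. -/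
theorem enorm_bilinear_le_threshold {α : Type*} [MeasurableSpace α] {μ : Measure α} [SFinite μ]
    {k : α × α → ℂ} (hk : Measurable k) {A : ℝ}
    (hA : ∀ z, ‖k z‖ ≤ A) {D : ℝ≥0∞} (hDt : D ≠ ∞)
    (hD : ∀ f h : α → ℂ, Measurable f → Measurable h → Integrable f μ → Integrable h μ →
      ‖∫ z, f z.1 * h z.2 * k z ∂μ.prod μ‖ₑ
        ≤ D * ((∫⁻ x, ‖f x‖ₑ ^ (2 : ℝ) ∂μ) ^ (1 / 2 : ℝ) *
          (∫⁻ x, ‖h x‖ₑ ^ (2 : ℝ) ∂μ) ^ (1 / 2 : ℝ)))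
    {p : ℝ} (hp1 : 1 < p) (hp2 : p < 2) {f h : α → ℂ} (hf : Measurable f) (hh : Measurable h)
    (hfi : Integrable f μ) (hhi : Integrable h μ) {l : ℝ} (hl : 0 < l) :
    ‖∫ z, f z.1 * h z.2 * k z ∂μ.prod μ‖ₑ
      ≤ ENNReal.ofReal A * (ENNReal.ofReal ((l / Real.exp 1) ^ (1 - p)) *
          ((∫⁻ x, ‖f x‖ₑ ^ p ∂μ) * ∫⁻ x, ‖h x‖ₑ ^ p ∂μ))
        + D * ((ENNReal.ofReal (l ^ (2 - p) / (2 - p)) * ∫⁻ x, ‖f x‖ₑ ^ p ∂μ) ^ (1 / 2 : ℝ)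
          * (∫⁻ x, ‖h x‖ₑ ^ p ∂μ) ^ (1 / 2 : ℝ)) := by
  have hS := measurable_levelSlice hh
  have hlo := measurable_lowPart hf l
  have hhi' := measurable_highPart hf l
  have hSm : ∀ σ, Measurable (levelSlice h σ) := fun σ => hS.comp measurable_prodMk_right
  have hlom : ∀ σ, Measurable (lowPart f l σ) := fun σ => hlo.comp measurable_prodMk_right
  have hhim : ∀ σ, Measurable (highPart f l σ) := fun σ => hhi'.comp measurable_prodMk_right
  have hSi : ∀ σ, Integrable (levelSlice h σ) μ := fun σ =>
    hhi.mono (hSm σ).aestronglyMeasurable (ae_of_all _ fun y => by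
      rw [levelSlice]; exact norm_indicator_le_norm_self _ _)
  have hloi : ∀ σ, Integrable (lowPart f l σ) μ := fun σ =>
    hfi.mono (hlom σ).aestronglyMeasurable (ae_of_all _ fun y => by
      rw [lowPart]; split_ifs <;> simp)
  have hhii : ∀ σ, Integrable (highPart f l σ) μ := fun σ =>
    hfi.mono (hhim σ).aestronglyMeasurable (ae_of_all _ fun y => by
      rw [highPart]; split_ifs <;> simp)
  have hbig : Integrable (Function.uncurry fun (z : α × α) (σ : ℝ) =>
      f z.1 * levelSlice h σ z.2 * k z) ((μ.prod μ).prod volume) := by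
    have hm : Measurable (Function.uncurry fun (z : α × α) (σ : ℝ) =>
        f z.1 * levelSlice h σ z.2 * k z) := by
      refine Measurable.mul (Measurable.mul (by fun_prop) ?_) (hk.comp measurable_fst)
      exact hS.comp (g := fun z : α × ℝ => levelSlice h z.2 z.1)
        (f := fun w : (α × α) × ℝ => (w.1.2, w.2)) (by fun_prop)
    refine ⟨hm.aestronglyMeasurable, ?_⟩
    rw [hasFiniteIntegral_iff_enorm, lintegral_prod _ hm.enorm.aemeasurable]
    refine lt_of_le_of_lt (lintegral_mono fun z => ?_)
      (integrable_mul_mul_kernel hk hA hfi hhi).hasFiniteIntegral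
    simp only [Function.uncurry, enorm_mul]
    rw [lintegral_mul_const' _ _ enorm_ne_top, lintegral_const_mul' _ _ enorm_ne_top]
    gcongr
    exact lintegral_levelSlice_le h z.2
  have hrep : ∫ z, f z.1 * h z.2 * k z ∂μ.prod μ
      = ∫ σ, ∫ z, f z.1 * levelSlice h σ z.2 * k z ∂μ.prod μ := by
    rw [← integral_integral_swap hbig]
    refine integral_congr_ae (ae_of_all _ fun z => ?_)
    simp only
    rw [integral_mul_const, integral_const_mul, integral_levelSlice]
  have hsplit : ∀ σ, ‖∫ z, f z.1 * levelSlice h σ z.2 * k z ∂μ.prod μ‖ₑ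
      ≤ (∫⁻ z, ‖highPart f l σ z.1‖ₑ * ‖levelSlice h σ z.2‖ₑ * ‖k z‖ₑ ∂μ.prod μ)
        + D * ((∫⁻ x, ‖lowPart f l σ x‖ₑ ^ (2 : ℝ) ∂μ) ^ (1 / 2 : ℝ)
          * (∫⁻ x, ‖levelSlice h σ x‖ₑ ^ (2 : ℝ) ∂μ) ^ (1 / 2 : ℝ)) := by
    intro σ
    have : ∫ z, f z.1 * levelSlice h σ z.2 * k z ∂μ.prod μ
        = (∫ z, highPart f l σ z.1 * levelSlice h σ z.2 * k z ∂μ.prod μ)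
          + ∫ z, lowPart f l σ z.1 * levelSlice h σ z.2 * k z ∂μ.prod μ := by
      rw [← integral_add (integrable_mul_mul_kernel hk hA (hhii σ) (hSi σ))
        (integrable_mul_mul_kernel hk hA (hloi σ) (hSi σ))]
      refine integral_congr_ae (ae_of_all _ fun z => ?_)
      simp only
      rw [← lowPart_add_highPart f l σ z.1]; ring
    rw [this]
    refine (enorm_add_le _ _).trans (add_le_add ?_ (hD _ _ (hlom σ) (hSm σ) (hloi σ) (hSi σ)))
    refine (enorm_integral_le_lintegral_enorm _).trans (le_of_eq ?_)
    simp only [enorm_mul]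
  rw [hrep]
  refine (enorm_integral_le_lintegral_enorm _).trans ((lintegral_mono hsplit).trans ?_)
  rw [lintegral_add_left (measurable_highPart_mul_levelSlice hk hf hh l).lintegral_prod_right',
    lintegral_const_mul' _ _ hDt]
  gcongr
  · exact lintegral_highPart_mul_levelSlice_le hk hA hp1 hf hh hl
  · exact lintegral_lowPart_mul_levelSlice_le hp2 hf hh hl

/-- Real interpolation between an `L¹ × L¹` bound and an `L² × L²` bound for a bilinear form. -/
theorem enorm_bilinear_le {α : Type*} [MeasurableSpace α] {μ : Measure α} [SFinite μ]
    {k : α × α → ℂ} (hk : Measurable k) {A : ℝ} (hA0 : 0 < A)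
    (hA : ∀ z, ‖k z‖ ≤ A) {D : ℝ} (hD0 : 0 ≤ D)
    (hD : ∀ f h : α → ℂ, Measurable f → Measurable h → Integrable f μ → Integrable h μ →
      ‖∫ z, f z.1 * h z.2 * k z ∂μ.prod μ‖ₑ
        ≤ ENNReal.ofReal D * ((∫⁻ x, ‖f x‖ₑ ^ (2 : ℝ) ∂μ) ^ (1 / 2 : ℝ) *
          (∫⁻ x, ‖h x‖ₑ ^ (2 : ℝ) ∂μ) ^ (1 / 2 : ℝ)))
    {p : ℝ} (hp1 : 1 < p) (hp2 : p < 2) {f h : α → ℂ} (hf : Measurable f) (hh : Measurable h)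
    (hfi : Integrable f μ) (hhi : Integrable h μ)
    (hX : ∫⁻ x, ‖f x‖ₑ ^ p ∂μ ≠ ∞) (hY : ∫⁻ x, ‖h x‖ₑ ^ p ∂μ ≠ ∞) :
    ‖∫ z, f z.1 * h z.2 * k z ∂μ.prod μ‖ₑ
      ≤ ENNReal.ofReal ((Real.exp 1 ^ (p - 1) + D * (1 / (2 - p)) ^ (1 / 2 : ℝ)) * A ^ (2 / p - 1))
        * ((∫⁻ x, ‖f x‖ₑ ^ p ∂μ) ^ (1 / p) * (∫⁻ x, ‖h x‖ₑ ^ p ∂μ) ^ (1 / p)) := by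
  have hp0 : 0 < p := by linarith
  have h2p : 0 < 2 - p := by linarith
  have hzero : ∀ {g : α → ℂ}, Measurable g → ∫⁻ x, ‖g x‖ₑ ^ p ∂μ = 0 →
      ∫⁻ x, ‖g x‖ₑ ^ (2 : ℝ) ∂μ = 0 := by
    intro g hg h0
    rw [lintegral_eq_zero_iff (by fun_prop)] at h0 ⊢
    filter_upwards [h0] with x hx
    simpa [hp0, not_lt.2 hp0.le] using hx
  rcases eq_or_ne (∫⁻ x, ‖f x‖ₑ ^ p ∂μ) 0 with h0 | hX0
  · have := hD f h hf hh hfi hhi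
    rw [hzero hf h0] at this
    simp only [one_div, inv_pos, Nat.ofNat_pos, ENNReal.zero_rpow_of_pos, zero_mul,
      mul_zero] at this
    exact this.trans zero_le
  rcases eq_or_ne (∫⁻ x, ‖h x‖ₑ ^ p ∂μ) 0 with h0 | hY0
  · have := hD f h hf hh hfi hhi
    rw [hzero hh h0] at this
    simp only [one_div, inv_pos, Nat.ofNat_pos, ENNReal.zero_rpow_of_pos, mul_zero] at this
    exact this.trans zero_le
  set X := ∫⁻ x, ‖f x‖ₑ ^ p ∂μ
  set Y := ∫⁻ x, ‖h x‖ₑ ^ p ∂μ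
  have hx := ENNReal.toReal_pos hX0 hX
  have hy := ENNReal.toReal_pos hY0 hY
  set x := X.toReal
  set y := Y.toReal
  have hXx : X = ENNReal.ofReal x := (ENNReal.ofReal_toReal hX).symm
  have hYy : Y = ENNReal.ofReal y := (ENNReal.ofReal_toReal hY).symm
  set l : ℝ := A ^ (2 / p) * (x * y) ^ (1 / p) with hl
  have hl0 : 0 < l := by positivity
  have he : 0 < Real.exp 1 := Real.exp_pos 1
  refine (enorm_bilinear_le_threshold hk hA ENNReal.ofReal_ne_top hD hp1 hp2 hf hh hfi hhi
    hl0).trans (le_of_eq ?_)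
  change ENNReal.ofReal A * (ENNReal.ofReal ((l / Real.exp 1) ^ (1 - p)) * (X * Y))
    + ENNReal.ofReal D * ((ENNReal.ofReal (l ^ (2 - p) / (2 - p)) * X) ^ (1 / 2 : ℝ)
      * Y ^ (1 / 2 : ℝ)) = _
  rw [hXx, hYy]
  rw [ENNReal.ofReal_rpow_of_pos hx, ENNReal.ofReal_rpow_of_pos hy,
    ENNReal.ofReal_rpow_of_pos hy, ← ENNReal.ofReal_mul (by positivity),
    ← ENNReal.ofReal_mul (by positivity), ← ENNReal.ofReal_mul (by positivity),
    ← ENNReal.ofReal_mul (by positivity), ENNReal.ofReal_rpow_of_pos (by positivity),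
    ← ENNReal.ofReal_mul (by positivity), ← ENNReal.ofReal_mul (by positivity),
    ← ENNReal.ofReal_mul (by positivity), ← ENNReal.ofReal_mul (by positivity),
    ← ENNReal.ofReal_add (by positivity) (by positivity)]
  congr 1
  have hxy : 0 < x * y := by positivity
  have e1 : A * (l ^ (1 - p) * (x * y)) = A ^ (2 / p - 1) * (x * y) ^ (1 / p) := by
    rw [hl, Real.mul_rpow (by positivity) (by positivity), ← Real.rpow_mul hA0.le,
      ← Real.rpow_mul hxy.le]
    have h1 : A * A ^ (2 / p * (1 - p)) = A ^ (2 / p - 1) := by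
      rw [show 2 / p - 1 = 1 + 2 / p * (1 - p) by field_simp; ring, Real.rpow_add hA0,
        Real.rpow_one]
    have h2 : (x * y) * (x * y) ^ (1 / p * (1 - p)) = (x * y) ^ (1 / p) := by
      have h3 : 1 / p = 1 + 1 / p * (1 - p) := by field_simp; ring
      conv_rhs => rw [h3, Real.rpow_add hxy, Real.rpow_one]
    rw [← h1, ← h2]; ring
  have e2 : (l ^ (2 - p) * (x * y)) ^ (1 / 2 : ℝ) = A ^ (2 / p - 1) * (x * y) ^ (1 / p) := by
    have h1 : l ^ (2 - p) = A ^ (2 / p * (2 - p)) * (x * y) ^ (1 / p * (2 - p)) := by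
      rw [hl, Real.mul_rpow (by positivity) (by positivity), ← Real.rpow_mul hA0.le,
        ← Real.rpow_mul hxy.le]
    have h2 : (x * y) ^ (1 / p * (2 - p)) * (x * y) = (x * y) ^ (2 / p) := by
      rw [show 2 / p = 1 / p * (2 - p) + 1 by field_simp; ring, Real.rpow_add hxy, Real.rpow_one]
    rw [h1, mul_assoc, h2, Real.mul_rpow (by positivity) (by positivity), ← Real.rpow_mul hA0.le,
      ← Real.rpow_mul hxy.le]
    congr 2 <;> (field_simp; try ring)
  have e3 : (l / Real.exp 1) ^ (1 - p) = l ^ (1 - p) * Real.exp 1 ^ (p - 1) := by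
    rw [Real.div_rpow hl0.le he.le, div_eq_mul_inv, ← Real.rpow_neg he.le]; ring_nf
  have e4 : (l ^ (2 - p) / (2 - p) * x) ^ (1 / 2 : ℝ) * y ^ (1 / 2 : ℝ)
      = (1 / (2 - p)) ^ (1 / 2 : ℝ) * (l ^ (2 - p) * (x * y)) ^ (1 / 2 : ℝ) := by
    rw [← Real.mul_rpow (by positivity) (by positivity),
      ← Real.mul_rpow (by positivity) (by positivity)]
    congr 1; ring
  rw [e3, e4, e2, ← Real.mul_rpow hx.le hy.le]
  linear_combination (Real.exp 1 ^ (p - 1)) * e1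


section FourierForm

open scoped ComplexConjugate

variable {V : Type*} [NormedAddCommGroup V] [InnerProductSpace ℝ V]

/-- The complex Gaussian kernel, the Fourier transform of `ξ ↦ exp (-b ‖ξ‖²)`. -/
def gaussKernel (b : ℂ) (x : V) : ℂ :=
  (Real.pi / b) ^ (Module.finrank ℝ V / 2 : ℂ) * Complex.exp (-(‖x‖ : ℂ) ^ 2 / (4 * b))

theorem norm_gaussKernel {b : ℂ} (x : V) :
    ‖gaussKernel b x‖ = (Real.pi / ‖b‖) ^ (Module.finrank ℝ V / 2 : ℝ)
      * Real.exp (-(1 / 4 * (b⁻¹).re) * ‖x‖ ^ 2) := by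
  have h1 : ((Module.finrank ℝ V : ℂ) / 2) = ((Module.finrank ℝ V / 2 : ℝ) : ℂ) := by push_cast; rfl
  have h2 : -(‖x‖ : ℂ) ^ 2 / (4 * b) = ((-(1 / 4) * ‖x‖ ^ 2 : ℝ) : ℂ) * b⁻¹ := by
    push_cast; rw [div_eq_mul_inv, mul_inv]; ring
  rw [gaussKernel, norm_mul, Complex.norm_exp, h1, Complex.norm_cpow_real, norm_div,
    Complex.norm_real, Real.norm_of_nonneg Real.pi_pos.le, h2, Complex.re_ofReal_mul]
  ring_nf

theorem norm_gaussKernel_le {b : ℂ} (hb : 0 < b.re) (x : V) :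
    ‖gaussKernel b x‖ ≤ (Real.pi / ‖b‖) ^ (Module.finrank ℝ V / 2 : ℝ) := by
  rw [norm_gaussKernel]
  refine mul_le_of_le_one_right (by positivity) (Real.exp_le_one_iff.2 ?_)
  have : 0 ≤ (b⁻¹).re := by rw [Complex.inv_re]; exact div_nonneg hb.le (Complex.normSq_nonneg _)
  have : 0 ≤ 1 / 4 * (b⁻¹).re * ‖x‖ ^ 2 := by positivity
  linarith

variable [MeasurableSpace V] [BorelSpace V]

theorem measurable_gaussKernel (b : ℂ) : Measurable (gaussKernel b : V → ℂ) := by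
  unfold gaussKernel; fun_prop

variable [FiniteDimensional ℝ V]

theorem integral_gauss_mul_phase {b : ℂ} (hb : 0 < b.re) (x : V) :
    ∫ ξ : V, Complex.exp (-b * ‖ξ‖ ^ 2) * Complex.exp (Complex.I * ⟪x, ξ⟫) = gaussKernel b x := by
  simp only [← Complex.exp_add]
  rw [GaussianFourier.integral_cexp_neg_mul_sq_norm_add hb, gaussKernel, Complex.I_sq]
  simp

theorem lintegral_enorm_gaussKernel {ε : ℝ} (hε : 0 < ε) :
    ∫⁻ x : V, ‖gaussKernel (ε : ℂ) x‖ₑ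
      = ENNReal.ofReal ((4 * Real.pi ^ 2) ^ (Module.finrank ℝ V / 2 : ℝ)) := by
  have hc : 0 < 1 / 4 * ε⁻¹ := by positivity
  have h1 : ∀ x : V, ‖gaussKernel (ε : ℂ) x‖ₑ = ENNReal.ofReal ((Real.pi / ε) ^
      (Module.finrank ℝ V / 2 : ℝ) * Real.exp (-(1 / 4 * ε⁻¹) * ‖x‖ ^ 2)) := fun x => by
    rw [← ofReal_norm, norm_gaussKernel, ← Complex.ofReal_inv, Complex.ofReal_re,
      Complex.norm_real, Real.norm_of_nonneg hε.le]
  have hint : Integrable fun x : V => Real.exp (-(1 / 4 * ε⁻¹) * ‖x‖ ^ 2) := by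
    refine Integrable.of_integral_ne_zero ?_
    rw [GaussianFourier.integral_rexp_neg_mul_sq_norm hc]
    positivity
  simp only [h1]
  rw [← ofReal_integral_eq_lintegral_ofReal (hint.const_mul _) (ae_of_all _ fun _ => by positivity),
    integral_const_mul, GaussianFourier.integral_rexp_neg_mul_sq_norm hc,
    ← Real.mul_rpow (by positivity) (by positivity)]
  congr 2; field_simp

/-- Unnormalized Fourier transform. -/
def phaseTransform (f : V → ℂ) (ξ : V) : ℂ := ∫ x, Complex.exp (Complex.I * ⟪x, ξ⟫) * f x

theorem norm_exp_I_mul_ofReal' (r : ℝ) : ‖Complex.exp (Complex.I * r)‖ = 1 := by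
  rw [mul_comm]; exact Complex.norm_exp_ofReal_mul_I r

theorem norm_phaseTransform_le (f : V → ℂ) (ξ : V) : ‖phaseTransform f ξ‖ ≤ ∫ x, ‖f x‖ := by
  refine (norm_integral_le_integral_norm _).trans (le_of_eq ?_)
  simp only [norm_mul, norm_exp_I_mul_ofReal', one_mul]

theorem measurable_phaseTransform {f : V → ℂ} (hf : Measurable f) :
    Measurable (phaseTransform f) := by
  have : StronglyMeasurable (Function.uncurry fun ξ x : V =>
      Complex.exp (Complex.I * ⟪x, ξ⟫) * f x) := by
    apply Measurable.stronglyMeasurable; fun_prop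
  exact this.integral_prod_right.measurable

theorem conj_phaseTransform (f : V → ℂ) (ξ : V) :
    conj (phaseTransform f ξ) = ∫ x, Complex.exp (-(Complex.I * ⟪x, ξ⟫)) * conj (f x) := by
  rw [phaseTransform, ← integral_conj]
  refine integral_congr_ae (ae_of_all _ fun x => ?_)
  simp [← Complex.exp_conj]

/-- The sesquilinear form with Gaussian multiplier on the Fourier side. -/
def gaussForm (b : ℂ) (f h : V → ℂ) : ℂ :=
  ∫ ξ, Complex.exp (-b * ‖ξ‖ ^ 2) * (phaseTransform f ξ * conj (phaseTransform h ξ))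

theorem integrable_gauss {b : ℂ} (hb : 0 < b.re) :
    Integrable fun ξ : V => Complex.exp (-b * ‖ξ‖ ^ 2) := by
  simpa using GaussianFourier.integrable_cexp_neg_mul_sq_norm_add hb 0 (0 : V)

theorem gaussForm_eq {b : ℂ} (hb : 0 < b.re) {f h : V → ℂ} (hfi : Integrable f)
    (hhi : Integrable h) :
    gaussForm b f h = ∫ z : V × V, f z.1 * conj (h z.2) * gaussKernel b (z.1 - z.2) := by
  have hhc : Integrable fun y => conj (h y) := Complex.conjCLE.integrable_comp_iff.2 hhi
  have hint : Integrable (Function.uncurry fun (ξ : V) (z : V × V) =>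
      Complex.exp (-b * ‖ξ‖ ^ 2) * (f z.1 * conj (h z.2))
        * Complex.exp (Complex.I * ⟪z.1 - z.2, ξ⟫)) (volume.prod (volume.prod volume)) := by
    refine ((integrable_gauss hb).mul_prod (hfi.mul_prod hhc)).mul_bdd (c := 1) ?_
      (ae_of_all _ fun w => (norm_exp_I_mul_ofReal' _).le)
    apply Measurable.aestronglyMeasurable; fun_prop
  have h1 : gaussForm b f h = ∫ ξ : V, ∫ z : V × V, Complex.exp (-b * ‖ξ‖ ^ 2) *
      (f z.1 * conj (h z.2)) * Complex.exp (Complex.I * ⟪z.1 - z.2, ξ⟫)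
        ∂(volume.prod volume) := by
    refine integral_congr_ae (ae_of_all _ fun ξ => ?_)
    simp only
    rw [conj_phaseTransform, phaseTransform, ← integral_prod_mul, ← integral_const_mul]
    refine integral_congr_ae (ae_of_all _ fun z => ?_)
    simp only
    rw [inner_sub_left, Complex.ofReal_sub, mul_sub, sub_eq_add_neg, Complex.exp_add]
    ring
  rw [h1, integral_integral_swap hint]
  refine integral_congr_ae (ae_of_all _ fun z => ?_)
  simp only
  rw [← integral_gauss_mul_phase hb, ← integral_const_mul]
  refine integral_congr_ae (ae_of_all _ fun ξ => ?_)
  simp only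
  ring

theorem lintegral_gauss_mul_sq {ε : ℝ} (hε : 0 < ε) {H : V → ℂ} (hH : Measurable H) {M : ℝ}
    (hM : ∀ ξ, ‖H ξ‖ ≤ M) :
    ∫⁻ ξ, ENNReal.ofReal (Real.exp (-ε * ‖ξ‖ ^ 2)) * ‖H ξ‖ₑ ^ (2 : ℝ)
      = ‖∫ ξ, Complex.exp (-(ε : ℂ) * ‖ξ‖ ^ 2) * (H ξ * conj (H ξ))‖ₑ := by
  have hcast : ∀ ξ : V, Complex.exp (-(ε : ℂ) * ‖ξ‖ ^ 2) * (H ξ * conj (H ξ))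
      = ((Real.exp (-ε * ‖ξ‖ ^ 2) * ‖H ξ‖ ^ 2 : ℝ) : ℂ) := fun ξ => by
    rw [Complex.mul_conj, Complex.normSq_eq_norm_sq]; push_cast; rfl
  have hg : Integrable fun ξ : V => Real.exp (-ε * ‖ξ‖ ^ 2) := by
    refine Integrable.of_integral_ne_zero ?_
    rw [GaussianFourier.integral_rexp_neg_mul_sq_norm hε]
    positivity
  have hi : Integrable fun ξ : V => Real.exp (-ε * ‖ξ‖ ^ 2) * ‖H ξ‖ ^ 2 := by
    refine hg.mul_bdd (c := M ^ 2) (by fun_prop) (ae_of_all _ fun ξ => ?_)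
    rw [Real.norm_of_nonneg (by positivity)]
    exact pow_le_pow_left₀ (norm_nonneg _) (hM ξ) 2
  simp only [hcast]
  rw [integral_complex_ofReal, ← ofReal_norm, Complex.norm_real, Real.norm_of_nonneg
    (integral_nonneg fun ξ => by positivity), ofReal_integral_eq_lintegral_ofReal hi
    (ae_of_all _ fun ξ => by positivity)]
  refine lintegral_congr fun ξ => ?_
  rw [ENNReal.ofReal_mul (Real.exp_pos _).le, ENNReal.ofReal_pow (norm_nonneg _), ofReal_norm]
  norm_cast

theorem lintegral_gauss_mul_phaseTransform_sq_le {ε : ℝ} (hε : 0 < ε) {f : V → ℂ}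
    (hf : Measurable f) (hfi : Integrable f) :
    ∫⁻ ξ, ENNReal.ofReal (Real.exp (-ε * ‖ξ‖ ^ 2)) * ‖phaseTransform f ξ‖ₑ ^ (2 : ℝ)
      ≤ ENNReal.ofReal ((4 * Real.pi ^ 2) ^ (Module.finrank ℝ V / 2 : ℝ))
        * ∫⁻ x, ‖f x‖ₑ ^ (2 : ℝ) := by
  rw [lintegral_gauss_mul_sq hε (measurable_phaseTransform hf) (norm_phaseTransform_le f)]
  change ‖gaussForm (ε : ℂ) f f‖ₑ ≤ _
  rw [gaussForm_eq (by simpa using hε) hfi hfi]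
  refine (enorm_integral_le_lintegral_enorm _).trans ?_
  have hk := measurable_gaussKernel (V := V) (ε : ℂ)
  set D := ENNReal.ofReal ((4 * Real.pi ^ 2) ^ (Module.finrank ℝ V / 2 : ℝ)) with hD
  have hkz : Measurable fun z : V × V => gaussKernel (ε : ℂ) (z.1 - z.2) :=
    hk.comp (by fun_prop)
  have hf1 : Measurable fun z : V × V =>
      ‖f z.1‖ₑ ^ (2 : ℝ) * ‖gaussKernel (ε : ℂ) (z.1 - z.2)‖ₑ := by
    fun_prop
  have hf2 : Measurable fun z : V × V =>
      ‖f z.2‖ₑ ^ (2 : ℝ) * ‖gaussKernel (ε : ℂ) (z.1 - z.2)‖ₑ := by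
    fun_prop
  have hcs := ENNReal.lintegral_mul_norm_pow_le (μ := (volume : Measure (V × V)))
    hf1.aemeasurable hf2.aemeasurable
    (p := 1 / 2) (q := 1 / 2) (by norm_num) (by norm_num) (by norm_num)
  have e1 : ∫⁻ z : V × V, ‖f z.1‖ₑ ^ (2 : ℝ) * ‖gaussKernel (ε : ℂ) (z.1 - z.2)‖ₑ
      = D * ∫⁻ x, ‖f x‖ₑ ^ (2 : ℝ) := by
    rw [Measure.volume_eq_prod, lintegral_prod _ hf1.aemeasurable,
      ← lintegral_const_mul _ (by fun_prop)]
    refine lintegral_congr fun x => ?_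
    dsimp only
    rw [lintegral_const_mul' _ _ (ENNReal.rpow_ne_top_of_nonneg (by norm_num) enorm_ne_top),
      lintegral_sub_left_eq_self (fun y => ‖gaussKernel (ε : ℂ) y‖ₑ) x,
      lintegral_enorm_gaussKernel hε, mul_comm]
  have e2 : ∫⁻ z : V × V, ‖f z.2‖ₑ ^ (2 : ℝ) * ‖gaussKernel (ε : ℂ) (z.1 - z.2)‖ₑ
      = D * ∫⁻ x, ‖f x‖ₑ ^ (2 : ℝ) := by
    rw [Measure.volume_eq_prod, lintegral_prod_symm _ hf2.aemeasurable,
      ← lintegral_const_mul _ (by fun_prop)]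
    refine lintegral_congr fun x => ?_
    dsimp only
    rw [lintegral_const_mul' _ _ (ENNReal.rpow_ne_top_of_nonneg (by norm_num) enorm_ne_top),
      lintegral_sub_right_eq_self (fun y => ‖gaussKernel (ε : ℂ) y‖ₑ) x,
      lintegral_enorm_gaussKernel hε, mul_comm]
  rw [e1, e2, ← ENNReal.rpow_add_of_nonneg _ _ (by norm_num) (by norm_num)] at hcs
  norm_num only [ENNReal.rpow_one] at hcs
  refine le_trans (le_of_eq (lintegral_congr fun z => ?_)) hcs
  have hsq : ∀ c : ℝ≥0∞, (c ^ (2 : ℝ)) ^ (1 / 2 : ℝ) = c := fun c => by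
    rw [← ENNReal.rpow_mul]; norm_num
  have hsq' : ∀ c : ℝ≥0∞, c ^ (1 / 2 : ℝ) * c ^ (1 / 2 : ℝ) = c := fun c => by
    rw [← ENNReal.rpow_add_of_nonneg _ _ (by norm_num) (by norm_num)]; norm_num
  rw [ENNReal.mul_rpow_of_nonneg _ _ (by norm_num), ENNReal.mul_rpow_of_nonneg _ _ (by norm_num),
    hsq, hsq, mul_mul_mul_comm, hsq', enorm_mul, enorm_mul, RCLike.enorm_conj]

theorem enorm_gaussForm_le_L2 {b : ℂ} (hb : 0 < b.re) {f h : V → ℂ} (hf : Measurable f)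
    (hh : Measurable h) (hfi : Integrable f) (hhi : Integrable h) :
    ‖gaussForm b f h‖ₑ ≤ ENNReal.ofReal ((4 * Real.pi ^ 2) ^ (Module.finrank ℝ V / 2 : ℝ))
      * ((∫⁻ x, ‖f x‖ₑ ^ (2 : ℝ)) ^ (1 / 2 : ℝ) * (∫⁻ x, ‖h x‖ₑ ^ (2 : ℝ)) ^ (1 / 2 : ℝ)) := by
  have hmf := measurable_phaseTransform hf
  have hmh := measurable_phaseTransform hh
  have hcs := ENNReal.lintegral_mul_norm_pow_le (μ := (volume : Measure V))
    (f := fun ξ => ENNReal.ofReal (Real.exp (-b.re * ‖ξ‖ ^ 2)) * ‖phaseTransform f ξ‖ₑ ^ (2 : ℝ))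
    (g := fun ξ => ENNReal.ofReal (Real.exp (-b.re * ‖ξ‖ ^ 2)) * ‖phaseTransform h ξ‖ₑ ^ (2 : ℝ))
    (by fun_prop) (by fun_prop)
    (p := 1 / 2) (q := 1 / 2) (by norm_num) (by norm_num) (by norm_num)
  have hsq : ∀ c : ℝ≥0∞, (c ^ (2 : ℝ)) ^ (1 / 2 : ℝ) = c := fun c => by
    rw [← ENNReal.rpow_mul]; norm_num
  have hsq' : ∀ c : ℝ≥0∞, c ^ (1 / 2 : ℝ) * c ^ (1 / 2 : ℝ) = c := fun c => by
    rw [← ENNReal.rpow_add_of_nonneg _ _ (by norm_num) (by norm_num)]; norm_num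
  refine (enorm_integral_le_lintegral_enorm _).trans (le_trans (le_of_eq ?_) (hcs.trans ?_))
  · refine lintegral_congr fun ξ => ?_
    rw [ENNReal.mul_rpow_of_nonneg _ _ (by norm_num), ENNReal.mul_rpow_of_nonneg _ _ (by norm_num),
      hsq, hsq, mul_mul_mul_comm, hsq', enorm_mul, enorm_mul, RCLike.enorm_conj]
    congr 1
    rw [← ofReal_norm, Complex.norm_exp]
    rw [← Complex.ofReal_pow, Complex.re_mul_ofReal, Complex.neg_re]
  · refine (mul_le_mul' (ENNReal.rpow_le_rpow
      (lintegral_gauss_mul_phaseTransform_sq_le hb hf hfi) (by norm_num)) (ENNReal.rpow_le_rpow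
      (lintegral_gauss_mul_phaseTransform_sq_le hb hh hhi) (by norm_num))).trans (le_of_eq ?_)
    rw [ENNReal.mul_rpow_of_nonneg _ _ (by norm_num), ENNReal.mul_rpow_of_nonneg _ _ (by norm_num),
      mul_mul_mul_comm, hsq']

/-- The constant in the dispersive `L^p` estimate. -/
def dispersiveConst (n : ℕ) (p a : ℝ) : ℝ :=
  (Real.exp 1 ^ (p - 1) + (4 * Real.pi ^ 2) ^ (n / 2 : ℝ) * (1 / (2 - p)) ^ (1 / 2 : ℝ))
    * Real.pi ^ a

/-- Dispersive estimate: the `L^p × L^p` bound for the regularized Schrödinger form. -/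
theorem enorm_gaussForm_le {ε τ : ℝ} (hε : 0 < ε) {p a : ℝ} (hp1 : 1 < p) (hp2 : p < 2)
    (ha : a = Module.finrank ℝ V / 2 * (2 / p - 1)) (ha0 : 0 < a)
    {f h : V → ℂ} (hf : Measurable f) (hh : Measurable h) (hfi : Integrable f)
    (hhi : Integrable h) (hX : ∫⁻ x, ‖f x‖ₑ ^ p ≠ ∞) (hY : ∫⁻ x, ‖h x‖ₑ ^ p ≠ ∞) :
    ‖gaussForm (ε - τ * Complex.I) f h‖ₑ
      ≤ ENNReal.ofReal (dispersiveConst (Module.finrank ℝ V) p a) * ‖τ‖ₑ ^ (-a)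
        * ((∫⁻ x, ‖f x‖ₑ ^ p) ^ (1 / p) * (∫⁻ x, ‖h x‖ₑ ^ p) ^ (1 / p)) := by
  set b : ℂ := ε - τ * Complex.I with hbdef
  have hb : 0 < b.re := by simpa [hbdef] using hε
  have hb0 : 0 < ‖b‖ := norm_pos_iff.2 fun h0 => by rw [h0] at hb; simp at hb
  have hhc : Integrable fun y => conj (h y) := Complex.conjCLE.integrable_comp_iff.2 hhi
  have hk : Measurable fun z : V × V => gaussKernel b (z.1 - z.2) :=
    (measurable_gaussKernel b).comp (by fun_prop)
  have h2p : 0 < 2 - p := by linarith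
  have key := enorm_bilinear_le (μ := (volume : Measure V)) hk
    (A := (Real.pi / ‖b‖) ^ (Module.finrank ℝ V / 2 : ℝ)) (by positivity)
    (fun z => norm_gaussKernel_le hb _)
    (D := (4 * Real.pi ^ 2) ^ (Module.finrank ℝ V / 2 : ℝ)) (by positivity)
    (fun f h hf hh hfi hhi => by
      have hhi' : Integrable fun y => conj (h y) := Complex.conjCLE.integrable_comp_iff.2 hhi
      have := enorm_gaussForm_le_L2 hb hf (h := fun y => conj (h y))
        (Complex.continuous_conj.measurable.comp hh) hfi hhi'
      rw [gaussForm_eq hb hfi hhi'] at this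
      simpa only [Complex.conj_conj, RCLike.enorm_conj, ← Measure.volume_eq_prod] using this)
    hp1 hp2 hf (h := fun y => conj (h y)) (Complex.continuous_conj.measurable.comp hh) hfi hhc hX
    (by simpa only [RCLike.enorm_conj] using hY)
  rw [gaussForm_eq hb hfi hhi]
  refine key.trans ?_
  simp only [RCLike.enorm_conj]
  gcongr
  rw [← Real.rpow_mul (by positivity), ← ha, dispersiveConst, Real.div_rpow Real.pi_pos.le hb0.le,
    div_eq_mul_inv (Real.pi ^ a), ← mul_assoc, ENNReal.ofReal_mul (by positivity)]
  gcongr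
  rw [ENNReal.ofReal_inv_of_pos (by positivity), ENNReal.rpow_neg, ENNReal.inv_le_inv,
    ← ENNReal.ofReal_rpow_of_pos hb0]
  refine ENNReal.rpow_le_rpow ?_ ha0.le
  rw [← ofReal_norm]
  refine ENNReal.ofReal_le_ofReal ?_
  have := Complex.abs_im_le_norm b
  simpa [hbdef] using this

end FourierForm

section SpaceTime

open scoped ComplexConjugate

variable {V : Type*} [NormedAddCommGroup V] [InnerProductSpace ℝ V] [FiniteDimensional ℝ V]
  [MeasurableSpace V] [BorelSpace V]

/-- The spatial phase transform of the time slice of `F`, modulated by the Schrödinger phase. -/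
def modulatedSlice (F : ℝ × V → ℂ) (t : ℝ) (ξ : V) : ℂ :=
  Complex.exp (Complex.I * (t * ‖ξ‖ ^ 2 : ℝ)) * phaseTransform (fun x => F (t, x)) ξ

/-- The dual Strichartz operator: the space-time phase transform restricted to the paraboloid. -/
def paraboloidTransform (F : ℝ × V → ℂ) (ξ : V) : ℂ := ∫ t, modulatedSlice F t ξ

theorem norm_modulatedSlice_le (F : ℝ × V → ℂ) (t : ℝ) (ξ : V) :
    ‖modulatedSlice F t ξ‖ ≤ ∫ x, ‖F (t, x)‖ := by
  rw [modulatedSlice, norm_mul, norm_exp_I_mul_ofReal', one_mul]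
  exact norm_phaseTransform_le _ _

theorem measurable_modulatedSlice {F : ℝ × V → ℂ} (hF : Measurable F) :
    Measurable fun w : ℝ × V => modulatedSlice F w.1 w.2 := by
  have h1 : StronglyMeasurable (Function.uncurry fun (w : ℝ × V) (x : V) =>
      Complex.exp (Complex.I * ⟪x, w.2⟫) * F (w.1, x)) := by
    apply Measurable.stronglyMeasurable
    have : Measurable fun v : (ℝ × V) × V => F (v.1.1, v.2) := hF.comp (by fun_prop)
    fun_prop
  have h2 : Measurable fun w : ℝ × V => phaseTransform (fun x => F (w.1, x)) w.2 :=
    h1.integral_prod_right.measurable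
  unfold modulatedSlice
  fun_prop

theorem measurable_paraboloidTransform {F : ℝ × V → ℂ} (hF : Measurable F) :
    Measurable (paraboloidTransform F) := by
  have h1 : Measurable fun w : V × ℝ => modulatedSlice F w.2 w.1 :=
    (measurable_modulatedSlice hF).comp measurable_swap
  exact h1.stronglyMeasurable.integral_prod_right.measurable

theorem norm_paraboloidTransform_le {F : ℝ × V → ℂ} (hFi : Integrable F) (ξ : V) :
    ‖paraboloidTransform F ξ‖ ≤ ∫ t, ∫ x, ‖F (t, x)‖ :=
  norm_integral_le_of_norm_le hFi.integral_norm_prod_left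
    (ae_of_all _ fun t => norm_modulatedSlice_le F t ξ)

theorem integral_gauss_mul_paraboloidTransform {ε : ℝ} (hε : 0 < ε) {F : ℝ × V → ℂ}
    (hF : Measurable F) (hFi : Integrable F) :
    ∫ ξ, Complex.exp (-(ε : ℂ) * ‖ξ‖ ^ 2)
        * (paraboloidTransform F ξ * conj (paraboloidTransform F ξ))
      = ∫ z : ℝ × ℝ, gaussForm (ε - (z.1 - z.2 : ℝ) * Complex.I)
          (fun x => F (z.1, x)) (fun x => F (z.2, x)) := by
  have hG := measurable_modulatedSlice hF
  have hint : Integrable (Function.uncurry fun (ξ : V) (z : ℝ × ℝ) =>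
      Complex.exp (-(ε : ℂ) * ‖ξ‖ ^ 2)
        * (modulatedSlice F z.1 ξ * conj (modulatedSlice F z.2 ξ)))
      (volume.prod (volume.prod volume)) := by
    have hN : Integrable fun t : ℝ => ∫ x, ‖F (t, x)‖ := hFi.integral_norm_prod_left
    refine ((integrable_gauss (V := V) (b := ε) (by simpa using hε)).norm.mul_prod
      (hN.mul_prod hN)).mono' ?_ (ae_of_all _ fun w => ?_)
    · have h1 : Measurable fun w : V × ℝ × ℝ => modulatedSlice F w.2.1 w.1 :=
        hG.comp (g := fun w : ℝ × V => modulatedSlice F w.1 w.2)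
          (f := fun w : V × ℝ × ℝ => (w.2.1, w.1)) (by fun_prop)
      have h2 : Measurable fun w : V × ℝ × ℝ => modulatedSlice F w.2.2 w.1 :=
        hG.comp (g := fun w : ℝ × V => modulatedSlice F w.1 w.2)
          (f := fun w : V × ℝ × ℝ => (w.2.2, w.1)) (by fun_prop)
      have h3 : Measurable fun w : V × ℝ × ℝ => conj (modulatedSlice F w.2.2 w.1) :=
        Complex.continuous_conj.measurable.comp h2
      apply Measurable.aestronglyMeasurable
      unfold Function.uncurry
      fun_prop
    · simp only [Function.uncurry, norm_mul, RCLike.norm_conj]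
      gcongr
      · exact norm_modulatedSlice_le F _ _
      · exact norm_modulatedSlice_le F _ _
  calc
    _ = ∫ ξ : V, ∫ z : ℝ × ℝ, Complex.exp (-(ε : ℂ) * ‖ξ‖ ^ 2)
        * (modulatedSlice F z.1 ξ * conj (modulatedSlice F z.2 ξ)) ∂(volume.prod volume) := by
      refine integral_congr_ae (ae_of_all _ fun ξ => ?_)
      simp only
      rw [integral_const_mul, paraboloidTransform, ← integral_conj, ← integral_prod_mul]
    _ = _ := by
      rw [integral_integral_swap hint]
      refine integral_congr_ae (ae_of_all _ fun z => ?_)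
      refine integral_congr_ae (ae_of_all _ fun ξ => ?_)
      simp only [modulatedSlice, map_mul, ← Complex.exp_conj, Complex.conj_I, Complex.conj_ofReal]
      have : -((ε : ℂ) - (z.1 - z.2 : ℝ) * Complex.I) * ‖ξ‖ ^ 2 = -(ε : ℂ) * ‖ξ‖ ^ 2
          + (Complex.I * (z.1 * ‖ξ‖ ^ 2 : ℝ) + -Complex.I * (z.2 * ‖ξ‖ ^ 2 : ℝ)) := by
        push_cast; ring
      rw [this, Complex.exp_add, Complex.exp_add]
      ring

/-- The constant in the dual Strichartz estimate in dimension `n`. -/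
def dualStrichartzConst (n : ℕ) (p a : ℝ) : ℝ :=
  dispersiveConst n p a * (2 * (2 / (1 - a) + 2 ^ (a / 2)))

theorem lintegral_gauss_mul_paraboloidTransform_sq_le {ε : ℝ} (hε : 0 < ε) {p a : ℝ}
    (ha0 : 0 < a) (ha1 : a < 1) (hp : p = 2 / (2 - a))
    (ha : a = Module.finrank ℝ V / 2 * (2 / p - 1)) {F : ℝ × V → ℂ}
    (hF : Measurable F) (hFi : Integrable F) (hX : ∫⁻ z, ‖F z‖ₑ ^ p ≠ ∞) :
    ∫⁻ ξ, ENNReal.ofReal (Real.exp (-ε * ‖ξ‖ ^ 2)) * ‖paraboloidTransform F ξ‖ₑ ^ (2 : ℝ)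
      ≤ ENNReal.ofReal (dualStrichartzConst (Module.finrank ℝ V) p a)
        * (∫⁻ z, ‖F z‖ₑ ^ p) ^ (2 / p) := by
  have hp1 : 1 < p := by rw [hp, lt_div_iff₀ (by linarith)]; linarith
  have hp2 : p < 2 := by rw [hp, div_lt_iff₀ (by linarith)]; linarith
  have hp0 : 0 < p := by linarith
  have hFp : Measurable fun z => ‖F z‖ₑ ^ p := by fun_prop
  have hφ0 : Measurable fun t : ℝ => ∫⁻ x, ‖F (t, x)‖ₑ ^ p := hFp.lintegral_prod_right'
  have hsum : ∫⁻ t : ℝ, ∫⁻ x, ‖F (t, x)‖ₑ ^ p = ∫⁻ z, ‖F z‖ₑ ^ p := by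
    rw [Measure.volume_eq_prod, lintegral_prod _ hFp.aemeasurable]
  set φ : ℝ → ℝ≥0∞ := fun t => (∫⁻ x, ‖F (t, x)‖ₑ ^ p) ^ (1 / p) with hφdef
  have hφ : Measurable φ := hφ0.pow_const _
  have hφp : ∫⁻ t, φ t ^ p = ∫⁻ z, ‖F z‖ₑ ^ p := by
    rw [← hsum]
    refine lintegral_congr fun t => ?_
    rw [hφdef, ← ENNReal.rpow_mul, one_div_mul_cancel hp0.ne', ENNReal.rpow_one]
  have hgood : ∀ᵐ t : ℝ, Integrable (fun x => F (t, x)) ∧ ∫⁻ x, ‖F (t, x)‖ₑ ^ p ≠ ∞ := by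
    have h1 : ∀ᵐ t : ℝ, Integrable (fun x => F (t, x)) := hFi.prod_right_ae
    have h2 := ae_lt_top hφ0 (by rwa [hsum])
    filter_upwards [h1, h2] with t ht1 ht2 using ⟨ht1, ht2.ne⟩
  have hC : 0 ≤ dispersiveConst (Module.finrank ℝ V) p a := by
    have : 0 < 2 - p := by linarith
    unfold dispersiveConst; positivity
  rw [lintegral_gauss_mul_sq hε (measurable_paraboloidTransform hF)
    (norm_paraboloidTransform_le hFi), integral_gauss_mul_paraboloidTransform hε hF hFi]
  calc
    _ ≤ ∫⁻ z : ℝ × ℝ, ENNReal.ofReal (dispersiveConst (Module.finrank ℝ V) p a)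
          * (φ z.1 * φ z.2 * ‖z.1 - z.2‖ₑ ^ (-a)) := by
      refine (enorm_integral_le_lintegral_enorm _).trans (lintegral_mono_ae ?_)
      have g1 : ∀ᵐ z : ℝ × ℝ, Integrable (fun x => F (z.1, x)) ∧
          ∫⁻ x, ‖F (z.1, x)‖ₑ ^ p ≠ ∞ := Measure.quasiMeasurePreserving_fst.ae hgood
      have g2 : ∀ᵐ z : ℝ × ℝ, Integrable (fun x => F (z.2, x)) ∧
          ∫⁻ x, ‖F (z.2, x)‖ₑ ^ p ≠ ∞ := Measure.quasiMeasurePreserving_snd.ae hgood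
      filter_upwards [g1, g2] with z hz1 hz2
      refine (enorm_gaussForm_le hε hp1 hp2 ha ha0 (hF.comp (by fun_prop)) (hF.comp (by fun_prop))
        hz1.1 hz2.1 hz1.2 hz2.2).trans (le_of_eq ?_)
      rw [mul_assoc]
      congr 1
      exact mul_comm _ _
    _ = ENNReal.ofReal (dispersiveConst (Module.finrank ℝ V) p a)
          * ∫⁻ t, ∫⁻ s, φ t * φ s * ‖t - s‖ₑ ^ (-a) := by
      rw [lintegral_const_mul _ (by fun_prop), Measure.volume_eq_prod,
        lintegral_prod _ (by fun_prop)]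
    _ ≤ _ := by
      rw [dualStrichartzConst, ENNReal.ofReal_mul hC, mul_assoc, ← hφp]
      gcongr
      exact hardy_littlewood_sobolev ha0 ha1 hp hφ (by rwa [hφp])

/-- Dual Strichartz estimate. -/
theorem lintegral_paraboloidTransform_sq_le {p a : ℝ}
    (ha0 : 0 < a) (ha1 : a < 1) (hp : p = 2 / (2 - a))
    (ha : a = Module.finrank ℝ V / 2 * (2 / p - 1)) {F : ℝ × V → ℂ}
    (hF : Measurable F) (hFi : Integrable F) (hX : ∫⁻ z, ‖F z‖ₑ ^ p ≠ ∞) :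
    ∫⁻ ξ, ‖paraboloidTransform F ξ‖ₑ ^ (2 : ℝ)
      ≤ ENNReal.ofReal (dualStrichartzConst (Module.finrank ℝ V) p a)
        * (∫⁻ z, ‖F z‖ₑ ^ p) ^ (2 / p) := by
  have hT := measurable_paraboloidTransform hF
  have hlim : Filter.Tendsto (fun m : ℕ => ∫⁻ ξ : V,
      ENNReal.ofReal (Real.exp (-(1 / ((m : ℝ) + 1)) * ‖ξ‖ ^ 2))
        * ‖paraboloidTransform F ξ‖ₑ ^ (2 : ℝ)) Filter.atTop
      (nhds (∫⁻ ξ, ‖paraboloidTransform F ξ‖ₑ ^ (2 : ℝ))) := by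
    refine lintegral_tendsto_of_tendsto_of_monotone (fun m => by fun_prop)
      (ae_of_all _ fun ξ m k hmk => ?_) (ae_of_all _ fun ξ => ?_)
    · dsimp only
      gcongr
    · have h1 : Filter.Tendsto (fun m : ℕ =>
          ENNReal.ofReal (Real.exp (-(1 / ((m : ℝ) + 1)) * ‖ξ‖ ^ 2))) Filter.atTop (nhds 1) := by
        rw [← ENNReal.ofReal_one, ← Real.exp_zero]
        refine ENNReal.tendsto_ofReal ((Real.continuous_exp.tendsto 0).comp ?_)
        simpa using (tendsto_one_div_add_atTop_nhds_zero_nat (𝕜 := ℝ)).neg.mul_const (‖ξ‖ ^ 2)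
      simpa using ENNReal.Tendsto.mul_const h1 (Or.inl one_ne_zero)
  exact le_of_tendsto' hlim fun m =>
    lintegral_gauss_mul_paraboloidTransform_sq_le (by positivity) ha0 ha1 hp ha hF hFi hX

end SpaceTime

section Duality

open scoped ComplexConjugate

variable {V : Type*} [NormedAddCommGroup V] [InnerProductSpace ℝ V] [FiniteDimensional ℝ V]
  [MeasurableSpace V] [BorelSpace V]

/-- The free Schrödinger evolution with frequency profile `g`. -/
def schrodingerWave (g : V → ℂ) (z : ℝ × V) : ℂ :=
  ∫ ξ : V, Complex.exp (Complex.I * ((⟪z.2, ξ⟫ + z.1 * ‖ξ‖ ^ 2 : ℝ) : ℂ)) * g ξ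

theorem measurable_schrodingerWave {g : V → ℂ} (hg : Measurable g) :
    Measurable (schrodingerWave g) := by
  have : StronglyMeasurable (Function.uncurry fun (z : ℝ × V) (ξ : V) =>
      Complex.exp (Complex.I * ((⟪z.2, ξ⟫ + z.1 * ‖ξ‖ ^ 2 : ℝ) : ℂ)) * g ξ) := by
    apply Measurable.stronglyMeasurable; fun_prop
  exact this.integral_prod_right.measurable

theorem norm_schrodingerWave_le (g : V → ℂ) (z : ℝ × V) :
    ‖schrodingerWave g z‖ ≤ ∫ ξ, ‖g ξ‖ := by
  refine (norm_integral_le_integral_norm _).trans (le_of_eq ?_)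
  simp only [norm_mul, norm_exp_I_mul_ofReal', one_mul]

theorem paraboloidTransform_eq_integral {F : ℝ × V → ℂ} (hFi : Integrable F)
    (ξ : V) : paraboloidTransform F ξ =
      ∫ z : ℝ × V, Complex.exp (Complex.I * ((⟪z.2, ξ⟫ + z.1 * ‖ξ‖ ^ 2 : ℝ) : ℂ)) * F z := by
  have hi : Integrable fun z : ℝ × V =>
      Complex.exp (Complex.I * ((⟪z.2, ξ⟫ + z.1 * ‖ξ‖ ^ 2 : ℝ) : ℂ)) * F z := by
    refine hFi.bdd_mul (c := 1) ?_ (ae_of_all _ fun w => (norm_exp_I_mul_ofReal' _).le)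
    apply Measurable.aestronglyMeasurable; fun_prop
  rw [Measure.volume_eq_prod] at hi ⊢
  rw [integral_prod _ hi]
  refine integral_congr_ae (ae_of_all _ fun t => ?_)
  simp only
  rw [modulatedSlice, phaseTransform, ← integral_const_mul]
  refine integral_congr_ae (ae_of_all _ fun x => ?_)
  simp only
  rw [← mul_assoc, ← Complex.exp_add, Complex.ofReal_add, mul_add, add_comm]

theorem integral_mul_schrodingerWave {F : ℝ × V → ℂ} (hFi : Integrable F)
    {g : V → ℂ} (hgi : Integrable g) :
    ∫ z, F z * schrodingerWave g z = ∫ ξ, g ξ * paraboloidTransform F ξ := by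
  have hint : Integrable (Function.uncurry fun (z : ℝ × V) (ξ : V) =>
      F z * g ξ * Complex.exp (Complex.I * ((⟪z.2, ξ⟫ + z.1 * ‖ξ‖ ^ 2 : ℝ) : ℂ)))
      (volume.prod volume) := by
    refine (hFi.mul_prod hgi).mul_bdd (c := 1) ?_
      (ae_of_all _ fun w => (norm_exp_I_mul_ofReal' _).le)
    apply Measurable.aestronglyMeasurable; fun_prop
  calc
    _ = ∫ z : ℝ × V, ∫ ξ : V, F z * g ξ *
          Complex.exp (Complex.I * ((⟪z.2, ξ⟫ + z.1 * ‖ξ‖ ^ 2 : ℝ) : ℂ)) := by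
      refine integral_congr_ae (ae_of_all _ fun z => ?_)
      simp only
      rw [schrodingerWave, ← integral_const_mul]
      refine integral_congr_ae (ae_of_all _ fun ξ => ?_)
      simp only
      ring
    _ = _ := by
      rw [integral_integral_swap hint]
      refine integral_congr_ae (ae_of_all _ fun ξ => ?_)
      simp only
      rw [paraboloidTransform_eq_integral hFi, ← integral_const_mul]
      refine integral_congr_ae (ae_of_all _ fun z => ?_)
      simp only
      ring

theorem enorm_integral_mul_schrodingerWave_le {p a : ℝ}
    (ha0 : 0 < a) (ha1 : a < 1) (hp : p = 2 / (2 - a))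
    (ha : a = Module.finrank ℝ V / 2 * (2 / p - 1)) {F : ℝ × V → ℂ}
    (hF : Measurable F) (hFi : Integrable F) (hX : ∫⁻ z, ‖F z‖ₑ ^ p ≠ ∞)
    {g : V → ℂ} (hg : Measurable g) (hgi : Integrable g) :
    ‖∫ z, F z * schrodingerWave g z‖ₑ
      ≤ ENNReal.ofReal (dualStrichartzConst (Module.finrank ℝ V) p a) ^ (1 / 2 : ℝ)
        * (∫⁻ z, ‖F z‖ₑ ^ p) ^ (1 / p) * (∫⁻ ξ, ‖g ξ‖ₑ ^ (2 : ℝ)) ^ (1 / 2 : ℝ) := by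
  have hT := measurable_paraboloidTransform hF
  rw [integral_mul_schrodingerWave hFi hgi]
  refine (enorm_integral_le_lintegral_enorm _).trans ?_
  simp only [enorm_mul]
  refine (ENNReal.lintegral_mul_le_Lp_mul_Lq volume Real.HolderConjugate.two_two
    (by fun_prop) (by fun_prop)).trans ?_
  rw [mul_comm]
  gcongr
  refine (ENNReal.rpow_le_rpow (lintegral_paraboloidTransform_sq_le ha0 ha1 hp ha hF hFi hX)
    (by norm_num)).trans (le_of_eq ?_)
  rw [ENNReal.mul_rpow_of_nonneg _ _ (by norm_num), ← ENNReal.rpow_mul]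
  congr 2
  ring

/-- Strichartz estimate localized to a set of finite measure. -/
theorem setLIntegral_schrodingerWave_le {p q a : ℝ}
    (ha0 : 0 < a) (ha1 : a < 1) (hp : p = 2 / (2 - a))
    (ha : a = Module.finrank ℝ V / 2 * (2 / p - 1)) (hpq : p.HolderConjugate q)
    {g : V → ℂ} (hg : Measurable g) (hgi : Integrable g) {K : Set (ℝ × V)}
    (hK : MeasurableSet K) (hKf : volume K ≠ ∞) :
    (∫⁻ z in K, ‖schrodingerWave g z‖ₑ ^ q) ^ (1 / q)
      ≤ ENNReal.ofReal (dualStrichartzConst (Module.finrank ℝ V) p a) ^ (1 / 2 : ℝ)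
        * (∫⁻ ξ, ‖g ξ‖ₑ ^ (2 : ℝ)) ^ (1 / 2 : ℝ) := by
  have hq1 : 1 < q := hpq.symm.lt
  have hp0 : 0 < p := hpq.pos
  have hq0 : 0 < q := hpq.symm.pos
  set u := schrodingerWave g with hu
  have hum : Measurable u := measurable_schrodingerWave hg
  set M : ℝ := ∫ ξ, ‖g ξ‖ with hM
  have hM0 : 0 ≤ M := integral_nonneg fun _ => norm_nonneg _
  have huM : ∀ z, ‖u z‖ ≤ M := norm_schrodingerWave_le g
  set m := ∫⁻ z in K, ‖u z‖ₑ ^ q with hm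
  have hmf : m ≠ ∞ := by
    refine ne_top_of_le_ne_top (ENNReal.mul_ne_top (ENNReal.rpow_ne_top_of_nonneg hq0.le
      (ENNReal.ofReal_ne_top (r := M))) hKf) ?_
    rw [← setLIntegral_const]
    refine lintegral_mono fun z => ?_
    dsimp only
    gcongr
    rw [← ofReal_norm]
    exact ENNReal.ofReal_le_ofReal (huM z)
  set F : ℝ × V → ℂ := K.indicator fun z => conj (u z) * ((‖u z‖ ^ (q - 2) : ℝ) : ℂ) with hFdef
  have hFm : Measurable F := by
    have : Measurable fun z => conj (u z) := Complex.continuous_conj.measurable.comp hum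
    refine Measurable.indicator ?_ hK
    fun_prop
  have hnorm : ∀ z ∈ K, ‖F z‖ = ‖u z‖ ^ (q - 1) := fun z hz => by
    rw [hFdef, Set.indicator_of_mem hz, norm_mul, RCLike.norm_conj, Complex.norm_real,
      Real.norm_of_nonneg (by positivity)]
    rcases (norm_nonneg (u z)).eq_or_lt with h0 | h0
    · rw [← h0, zero_mul, Real.zero_rpow (by linarith)]
    · nth_rewrite 1 [← Real.rpow_one ‖u z‖]
      rw [← Real.rpow_add h0]
      ring_nf
  have hpow : ∀ z, ‖F z‖ₑ ^ p = K.indicator (fun z => ‖u z‖ₑ ^ q) z := fun z => by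
    by_cases hz : z ∈ K
    · rw [Set.indicator_of_mem hz, ← ofReal_norm, hnorm z hz,
        ← ENNReal.ofReal_rpow_of_nonneg (norm_nonneg _) (by linarith), ofReal_norm,
        ← ENNReal.rpow_mul]
      congr 1
      rw [hpq.symm.sub_one_mul_conj]
    · simp [hFdef, Set.indicator_of_notMem hz, hp0]
  have hFp : ∫⁻ z, ‖F z‖ₑ ^ p = m := by
    simp only [hpow]
    rw [lintegral_indicator hK]
  have hFi : Integrable F := by
    have : IntegrableOn F K := by
      refine Measure.integrableOn_of_bounded (M := M ^ (q - 1)) hKf hFm.aestronglyMeasurable ?_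
      filter_upwards [ae_restrict_mem hK] with z hz
      rw [hnorm z hz]
      exact Real.rpow_le_rpow (norm_nonneg _) (huM z) (by linarith)
    refine (integrableOn_iff_integrable_of_support_subset ?_).1 this
    exact Set.support_indicator_subset
  have hint : ∫ z, F z * u z = ((∫ z, K.indicator (fun z => ‖u z‖ ^ q) z : ℝ) : ℂ) := by
    rw [← integral_complex_ofReal]
    refine integral_congr_ae (ae_of_all _ fun z => ?_)
    dsimp only
    by_cases hz : z ∈ K
    · rw [hFdef, Set.indicator_of_mem hz, Set.indicator_of_mem hz, mul_right_comm,
        mul_comm (conj (u z)), Complex.mul_conj, Complex.normSq_eq_norm_sq, ← Complex.ofReal_mul]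
      congr 1
      rcases (norm_nonneg (u z)).eq_or_lt with h0 | h0
      · rw [← h0, Real.zero_rpow hq0.ne']; simp
      · rw [← Real.rpow_natCast, ← Real.rpow_add h0]
        congr 1
        push_cast; ring
    · simp [hFdef, Set.indicator_of_notMem hz]
  have hmint : ‖∫ z, F z * u z‖ₑ = m := by
    rw [hint, ← ofReal_norm, Complex.norm_real, Real.norm_of_nonneg
      (integral_nonneg fun z => Set.indicator_nonneg (fun _ _ => by positivity) z),
      integral_indicator hK, ofReal_integral_eq_lintegral_ofReal]
    · refine lintegral_congr fun z => ?_
      rw [← ENNReal.ofReal_rpow_of_nonneg (norm_nonneg _) hq0.le, ofReal_norm]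
    · refine Measure.integrableOn_of_bounded (M := M ^ q) hKf
        (by apply Measurable.aestronglyMeasurable; fun_prop) (ae_of_all _ fun z => ?_)
      rw [Real.norm_of_nonneg (by positivity)]
      exact Real.rpow_le_rpow (norm_nonneg _) (huM z) hq0.le
    · exact ae_of_all _ fun z => by positivity
  have key := enorm_integral_mul_schrodingerWave_le ha0 ha1 hp ha hFm hFi (by rwa [hFp]) hg hgi
  rw [← hu, hmint, hFp] at key
  rcases eq_or_ne m 0 with h0 | h0
  · rw [h0, ENNReal.zero_rpow_of_pos (by positivity)]; exact zero_le
  have hm1 : m ^ (1 / p) ≠ 0 := by simp [h0, hmf]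
  have hm2 : m ^ (1 / p) ≠ ∞ := ENNReal.rpow_ne_top_of_nonneg (by positivity) hmf
  have hsplit : m = m ^ (1 / p) * m ^ (1 / q) := by
    rw [← ENNReal.rpow_add _ _ h0 hmf, one_div, one_div, hpq.inv_add_inv_eq_one, ENNReal.rpow_one]
  nth_rewrite 1 [hsplit] at key
  rw [mul_comm _ (m ^ (1 / p)), mul_assoc] at key
  exact (ENNReal.mul_le_mul_iff_right hm1 hm2).1 key

theorem lintegral_schrodingerWave_le {p q a : ℝ}
    (ha0 : 0 < a) (ha1 : a < 1) (hp : p = 2 / (2 - a))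
    (ha : a = Module.finrank ℝ V / 2 * (2 / p - 1)) (hpq : p.HolderConjugate q)
    {g : V → ℂ} (hg : Measurable g) (hgi : Integrable g) :
    (∫⁻ z, ‖schrodingerWave g z‖ₑ ^ q) ^ (1 / q)
      ≤ ENNReal.ofReal (dualStrichartzConst (Module.finrank ℝ V) p a) ^ (1 / 2 : ℝ)
        * (∫⁻ ξ, ‖g ξ‖ₑ ^ (2 : ℝ)) ^ (1 / 2 : ℝ) := by
  have hq0 : 0 < q := hpq.symm.pos
  have hcov : ⋃ R : ℕ, Metric.closedBall (0 : ℝ × V) R = Set.univ := Metric.iUnion_closedBall_nat 0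
  have hmono : Monotone fun R : ℕ => Metric.closedBall (0 : ℝ × V) R := fun R S h =>
    Metric.closedBall_subset_closedBall (by exact_mod_cast h)
  rw [← setLIntegral_univ, ← hcov, setLIntegral_iUnion_of_directed _ hmono.directed_le,
    one_div, ENNReal.rpow_inv_le_iff hq0]
  refine iSup_le fun R => ?_
  rw [← ENNReal.rpow_inv_le_iff hq0, ← one_div]
  exact setLIntegral_schrodingerWave_le ha0 ha1 hp ha hpq hg hgi
    Metric.isClosed_closedBall.measurableSet
    measure_closedBall_lt_top.ne

end Duality

/-- Euclidean Strichartz estimate for the Schrödinger equation, endpoint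
Lebesgue exponent: for `g ∈ 𝒮(ℝ^n)`, the function
`u(t,x) = ∫ e^{i(x·ξ + t|ξ|²)} g(ξ) dξ` satisfies
`‖u‖_{L^{2(n+2)/n}(ℝ×ℝ^n)} ≤ C_n ‖g‖_{L²(ℝ^n)}`. -/
theorem stmt19 (n : ℕ) (hn : 1 ≤ n) :
    ∃ C : ℝ, 0 < C ∧
      ∀ g : SchwartzMap (EuclideanSpace ℝ (Fin n)) ℂ,
        eLpNorm
            (fun z : ℝ × EuclideanSpace ℝ (Fin n) =>
              ∫ ξ : EuclideanSpace ℝ (Fin n),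
                Complex.exp (Complex.I * ((⟪z.2, ξ⟫ + z.1 * ‖ξ‖ ^ 2 : ℝ) : ℂ)) * g ξ)
            (ENNReal.ofReal (2 * ((n : ℝ) + 2) / n)) volume
          ≤ ENNReal.ofReal C * eLpNorm (⇑g) 2 volume := by
  have hn0 : (0 : ℝ) < n := by exact_mod_cast hn
  set a : ℝ := n / (n + 2) with hadef
  set p : ℝ := 2 * (n + 2) / (n + 4) with hpdef
  set q : ℝ := 2 * (n + 2) / n with hqdef
  have ha0 : 0 < a := by positivity
  have ha1 : a < 1 := by rw [hadef, div_lt_one (by positivity)]; linarith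
  have hp : p = 2 / (2 - a) := by
    rw [hadef, hpdef]
    have : (2 : ℝ) - n / (n + 2) = (n + 4) / (n + 2) := by field_simp; ring
    rw [this]; field_simp
  have ha : a = Module.finrank ℝ (EuclideanSpace ℝ (Fin n)) / 2 * (2 / p - 1) := by
    rw [finrank_euclideanSpace_fin, hadef, hpdef]; field_simp; ring
  have hpq : p.HolderConjugate q := by
    rw [Real.holderConjugate_iff]
    constructor
    · rw [hpdef, lt_div_iff₀ (by positivity)]; linarith
    · rw [hpdef, hqdef]; field_simp; ring
  have hq0 : 0 < q := hpq.symm.pos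
  set D := dualStrichartzConst (Module.finrank ℝ (EuclideanSpace ℝ (Fin n))) p a with hD
  refine ⟨max D 0 ^ (1 / 2 : ℝ) + 1, by positivity, fun g => ?_⟩
  have key := lintegral_schrodingerWave_le ha0 ha1 hp ha hpq g.continuous.measurable g.integrable
  rw [eLpNorm_eq_lintegral_rpow_enorm_toReal (by simpa using hq0) ENNReal.ofReal_ne_top,
    eLpNorm_eq_lintegral_rpow_enorm_toReal two_ne_zero ENNReal.ofNat_ne_top,
    ENNReal.toReal_ofReal hq0.le, ENNReal.toReal_ofNat]
  refine key.trans (mul_le_mul' ?_ le_rfl)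
  refine (ENNReal.rpow_le_rpow (ENNReal.ofReal_le_ofReal (le_max_left D 0)) (by norm_num)).trans ?_
  rw [ENNReal.ofReal_rpow_of_nonneg (le_max_right _ _) (by norm_num)]
  exact ENNReal.ofReal_le_ofReal (by linarith)
end
end
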